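/- arXiv:2002.05750 — 2 statements merged into one kernel-verified Lean document; each statement's English description precedes it below -/
import Mathlib

section
/- Let (S_n) be the M₄(4,2) balanced excited random walk, let r_n = #{S_0,…,S_n} be the cardinality of its range at time n, let r_n^{(1)} be the number of times up to time n that the walk jumped using the first two coordinates while at a site visited for the first time, and r_n^{(2)} := r_n − r_n^{(1)}. Then for every M > 0 and each i ∈ {1,2} there exists a constant C > 0 such that P[ n/(C log n)² ≤ r_n^{(i)} ≤ 99n/100 ] = 1 − o(n^{−M}) as n → ∞. -/
open MeasureTheory Filter

/-- The `i`-th canonical unit vector of `ℤ^d`. -/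
def unitVec (d : ℕ) (i : Fin d) : Fin d → ℤ := fun j => if j = i then 1 else 0

/-- `S` is a balanced excited random walk `M_d(d₁,d₂)` under `P`:
it starts at `0` a.s., is measurable, and conditionally on any finite trajectory
`S_0 = h 0, …, S_n = h n`, if `h n` is a new site the walk jumps to `h n ± e_i`
with probability `1/(2d₁)` for each `i < d₁` (`0`-indexed), while if `h n` is an
old site it jumps to `h n ± e_i` with probability `1/(2d₂)` for each
`d - d₂ ≤ i < d` (`0`-indexed). -/
def IsBERW {Ω : Type*} [MeasurableSpace Ω] (d d₁ d₂ : ℕ) (P : Measure Ω)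
    (S : ℕ → Ω → Fin d → ℤ) : Prop :=
  (∀ n, Measurable (S n)) ∧
  (∀ᵐ ω ∂P, S 0 ω = 0) ∧
  (∀ (n : ℕ) (h : ℕ → Fin d → ℤ), (∀ k < n, h n ≠ h k) →
    ∀ i : Fin d, i.1 < d₁ → ∀ ε : ℤ, ε = 1 ∨ ε = -1 →
      P {ω | (∀ k ≤ n, S k ω = h k) ∧ S (n + 1) ω = h n + ε • unitVec d i}
        = P {ω | ∀ k ≤ n, S k ω = h k} / (2 * d₁)) ∧
  (∀ (n : ℕ) (h : ℕ → Fin d → ℤ), (∃ k < n, h n = h k) →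
    ∀ i : Fin d, d - d₂ ≤ i.1 → ∀ ε : ℤ, ε = 1 ∨ ε = -1 →
      P {ω | (∀ k ≤ n, S k ω = h k) ∧ S (n + 1) ω = h n + ε • unitVec d i}
        = P {ω | ∀ k ≤ n, S k ω = h k} / (2 * d₂))

/-- Transience: almost surely, every site is visited only finitely many times. -/
def IsTransientWalk {Ω : Type*} [MeasurableSpace Ω] (d : ℕ) (P : Measure Ω)
    (S : ℕ → Ω → Fin d → ℤ) : Prop :=
  ∀ᵐ ω ∂P, ∀ x : Fin d → ℤ, {n : ℕ | S n ω = x}.Finite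

/-- The cardinality of the range `{S_0, …, S_n}` of the walk at time `n`. -/
def rangeCard {Ω : Type*} [MeasurableSpace Ω] {d : ℕ} (S : ℕ → Ω → Fin d → ℤ)
    (n : ℕ) (ω : Ω) : ℕ :=
  ((Finset.range (n + 1)).image (fun k => S k ω)).card

open scoped Classical in
/-- `r_n^{(1)}`: the number of times `k ≤ n` at which the walk, being at a site
visited for the first time, jumped using one of the first two coordinates. -/
noncomputable def newXJumps {Ω : Type*} [MeasurableSpace Ω] (S : ℕ → Ω → Fin 4 → ℤ)
    (n : ℕ) (ω : Ω) : ℕ :=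
  ((Finset.range (n + 1)).filter
    (fun k => (∀ j < k, S k ω ≠ S j ω) ∧
      ∃ i : Fin 4, i.1 < 2 ∧ S (k + 1) ω i ≠ S k ω i)).card

/-- `r_n^{(2)} := r_n − r_n^{(1)}`. -/
noncomputable def newYJumps {Ω : Type*} [MeasurableSpace Ω] (S : ℕ → Ω → Fin 4 → ℤ)
    (n : ℕ) (ω : Ω) : ℕ :=
  rangeCard S n ω - newXJumps S n ω

namespace BERW

/-- The sign attached to a boolean. -/
def sgn (b : Bool) : ℤ := if b then 1 else -1

/-- The displacement `± e_i` in `ℤ⁴`. -/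
def step (i : Fin 4) (b : Bool) : Fin 4 → ℤ := sgn b • unitVec 4 i

/-- The coordinates used by the walk at old sites. -/
def oldCoord : Fin 2 → Fin 4 := ![2, 3]

/-- The path `h` stays in the boxes that a nearest neighbour path started at `0` can reach. -/
def Box (n : ℕ) (h : ℕ → Fin 4 → ℤ) : Prop := ∀ k ≤ n, ∀ i, |h k i| ≤ (k : ℤ)

/-- The event that the walk follows `h` up to time `n`. -/
def cyl {Ω : Type*} (S : ℕ → Ω → Fin 4 → ℤ) (n : ℕ) (h : ℕ → Fin 4 → ℤ) : Set Ω :=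
  {ω | ∀ k ≤ n, S k ω = h k}

/-- The path that follows `p` and then stays at the endpoint of `p`. -/
def extend {n : ℕ} (p : Fin (n + 1) → Fin 4 → ℤ) (k : ℕ) : Fin 4 → ℤ :=
  p ⟨min k n, by omega⟩

lemma step_injective : Function.Injective fun q : Fin 4 × Bool => step q.1 q.2 := by decide

lemma oldStep_injective :
    Function.Injective fun q : Fin 2 × Bool => step (oldCoord q.1) q.2 := by decide

lemma abs_step_le (i : Fin 4) (b : Bool) (j : Fin 4) : |step i b j| ≤ 1 := by
  revert i b j; decide

lemma ae_and_lintegral_of_uniform {Ω α ι : Type*} [MeasurableSpace Ω] [MeasurableSpace α]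
    [MeasurableSingletonClass α] [Fintype ι] (μ : Measure Ω) [IsFiniteMeasure μ] {Z : Ω → α}
    (hZ : Measurable Z) {v : ι → α} (hv : Function.Injective v) {c : ENNReal}
    (hprob : ∀ i, μ (Z ⁻¹' {v i}) = c) (hc : Fintype.card ι * c = μ Set.univ) :
    (∀ᵐ ω ∂μ, ∃ i, Z ω = v i) ∧ ∀ g : α → ENNReal, ∫⁻ ω, g (Z ω) ∂μ = ∑ i, g (v i) * c := by
  have hm : ∀ i, MeasurableSet (Z ⁻¹' {v i}) := fun i => hZ (measurableSet_singleton _)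
  have hd : Pairwise (Function.onFun Disjoint fun i => Z ⁻¹' {v i}) := by
    intro i j hij
    refine Set.disjoint_left.2 fun ω h1 h2 => hij (hv ?_)
    simp only [Set.mem_preimage, Set.mem_singleton_iff] at h1 h2
    rw [← h1, ← h2]
  have hU : μ (⋃ i, Z ⁻¹' {v i}) = μ Set.univ := by
    rw [measure_iUnion hd hm, tsum_fintype]
    simp [hprob, hc]
  have hae : ∀ᵐ ω ∂μ, ω ∈ ⋃ i, Z ⁻¹' {v i} := by
    rw [ae_iff]
    change μ (⋃ i, Z ⁻¹' {v i})ᶜ = 0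
    rw [measure_compl (MeasurableSet.iUnion hm) (measure_ne_top _ _), hU, tsub_self]
  refine ⟨?_, fun g => ?_⟩
  · filter_upwards [hae] with ω hω
    simpa using hω
  · rw [← Measure.restrict_eq_self_of_ae_mem hae, lintegral_iUnion hm hd, tsum_fintype]
    refine Finset.sum_congr rfl fun i _ => ?_
    rw [setLIntegral_congr_fun (g := fun _ => g (v i)) (hm i)
      (fun ω hω => by simp only [Set.mem_preimage, Set.mem_singleton_iff] at hω; simp [hω]),
      setLIntegral_const, hprob]

section

variable {Ω : Type*} {S : ℕ → Ω → Fin 4 → ℤ}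

lemma mem_cyl_extend (n : ℕ) (ω : Ω) :
    ω ∈ cyl S n (extend fun k : Fin (n + 1) => S k ω) := by
  intro k hk
  simp [extend, min_eq_left hk]

lemma iUnion_cyl (n : ℕ) :
    ⋃ p : Fin (n + 1) → Fin 4 → ℤ, cyl S n (extend p) = Set.univ :=
  Set.eq_univ_of_forall fun ω => Set.mem_iUnion.2 ⟨_, mem_cyl_extend n ω⟩

lemma disjoint_cyl (n : ℕ) :
    Pairwise (Function.onFun Disjoint
      fun p : Fin (n + 1) → Fin 4 → ℤ => cyl S n (extend p)) := by
  intro p q hpq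
  refine Set.disjoint_left.2 fun ω h1 h2 => hpq ?_
  ext1 k
  have hk : (k : ℕ) ≤ n := by omega
  have := (h1 k hk).symm.trans (h2 k hk)
  simpa [extend, min_eq_left hk] using this

variable [MeasurableSpace Ω] {P : Measure Ω}

lemma measurableSet_cyl (hS : ∀ n, Measurable (S n)) (n : ℕ) (h : ℕ → Fin 4 → ℤ) :
    MeasurableSet (cyl S n h) := by
  have : cyl S n h = ⋂ k, ⋂ (_ : k ≤ n), S k ⁻¹' {h k} := by
    ext ω; simp [cyl]
  rw [this]
  exact MeasurableSet.iInter fun k => MeasurableSet.iInter fun _ =>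
    hS k (measurableSet_singleton _)

variable [IsProbabilityMeasure P]

lemma new_site (hS : IsBERW 4 4 2 P S) {n : ℕ} {h : ℕ → Fin 4 → ℤ}
    (hn : ∀ k < n, h n ≠ h k) :
    (∀ᵐ ω ∂P.restrict (cyl S n h), ∃ q : Fin 4 × Bool, S (n + 1) ω = h n + step q.1 q.2) ∧
    ∀ g : (Fin 4 → ℤ) → ENNReal, ∫⁻ ω in cyl S n h, g (S (n + 1) ω) ∂P =
      ∑ q : Fin 4 × Bool, g (h n + step q.1 q.2) * (P (cyl S n h) / 8) := by
  refine ae_and_lintegral_of_uniform _ (hS.1 (n + 1))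
    ((add_right_injective (h n)).comp step_injective) ?_ ?_
  · rintro ⟨i, b⟩
    rw [Measure.restrict_apply (hS.1 _ (measurableSet_singleton _))]
    have := hS.2.2.1 n h hn i i.2 (sgn b) (by cases b <;> simp [sgn])
    norm_num at this
    rw [cyl, ← this]
    congr 1
    ext ω
    simp [step, and_comm]
  · simp only [Fintype.card_prod, Fintype.card_fin, Fintype.card_bool, Measure.restrict_apply_univ]
    norm_num
    exact ENNReal.mul_div_cancel (by norm_num) (by norm_num)

lemma old_site (hS : IsBERW 4 4 2 P S) {n : ℕ} {h : ℕ → Fin 4 → ℤ}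
    (hn : ∃ k < n, h n = h k) :
    (∀ᵐ ω ∂P.restrict (cyl S n h),
      ∃ q : Fin 2 × Bool, S (n + 1) ω = h n + step (oldCoord q.1) q.2) ∧
    ∀ g : (Fin 4 → ℤ) → ENNReal, ∫⁻ ω in cyl S n h, g (S (n + 1) ω) ∂P =
      ∑ q : Fin 2 × Bool, g (h n + step (oldCoord q.1) q.2) * (P (cyl S n h) / 4) := by
  refine ae_and_lintegral_of_uniform _ (hS.1 (n + 1))
    ((add_right_injective (h n)).comp oldStep_injective) ?_ ?_
  · rintro ⟨i, b⟩
    rw [Measure.restrict_apply (hS.1 _ (measurableSet_singleton _))]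
    have := hS.2.2.2 n h hn (oldCoord i) (by revert i; decide) (sgn b)
      (by cases b <;> simp [sgn])
    norm_num at this
    rw [cyl, ← this]
    congr 1
    ext ω
    simp [step, and_comm]
  · simp only [Fintype.card_prod, Fintype.card_fin, Fintype.card_bool, Measure.restrict_apply_univ]
    norm_num
    exact ENNReal.mul_div_cancel (by norm_num) (by norm_num)

lemma ae_increment (hS : IsBERW 4 4 2 P S) (n : ℕ) :
    ∀ᵐ ω ∂P, ∃ i b, S (n + 1) ω = S n ω + step i b := by
  rw [← Measure.restrict_univ (μ := P), ← iUnion_cyl (S := S) n, ae_restrict_iUnion_iff]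
  intro p
  have key : ∀ᵐ ω ∂P.restrict (cyl S n (extend p)),
      ∃ i b, S (n + 1) ω = extend p n + step i b := by
    by_cases hn : ∀ k < n, extend p n ≠ extend p k
    · filter_upwards [(new_site hS hn).1] with ω ⟨q, hq⟩ using ⟨_, _, hq⟩
    · push Not at hn
      filter_upwards [(old_site hS hn).1] with ω ⟨q, hq⟩ using ⟨_, _, hq⟩
  filter_upwards [key, ae_restrict_mem (measurableSet_cyl hS.1 n _)] with ω hω hmem
  rwa [hmem n le_rfl]

lemma ae_box (hS : IsBERW 4 4 2 P S) : ∀ᵐ ω ∂P, ∀ n, Box n fun k => S k ω := by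
  filter_upwards [hS.2.1, ae_all_iff.2 (ae_increment hS)] with ω h0 hω _ k hk
  clear hk
  induction k with
  | zero => simp [h0]
  | succ k ih =>
    intro i
    obtain ⟨j, b, hj⟩ := hω k
    have h1 := ih i
    have h2 := abs_step_le j b i
    simp only [hj, Pi.add_apply]
    push_cast
    exact (abs_add_le _ _).trans (add_le_add h1 h2)

/-- A functional of the path whose mean over the next step does not increase
is a supermartingale. -/
lemma lintegral_le_of_step (hS : IsBERW 4 4 2 P S) (N : ℕ) (φ : ℕ → (ℕ → Fin 4 → ℤ) → ℝ)
    (hdep : ∀ n h h', (∀ k ≤ n, h k = h' k) → φ n h = φ n h')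
    (hnonneg : ∀ n ≤ N, ∀ h, Box n h → 0 ≤ φ n h)
    (hnew : ∀ n < N, ∀ h, Box n h → (∀ k < n, h n ≠ h k) →
      ∑ q : Fin 4 × Bool, φ (n + 1) (Function.update h (n + 1) (h n + step q.1 q.2))
        ≤ 8 * φ n h)
    (hold : ∀ n < N, ∀ h, Box n h → (∃ k < n, h n = h k) →
      ∑ q : Fin 2 × Bool, φ (n + 1) (Function.update h (n + 1) (h n + step (oldCoord q.1) q.2))
        ≤ 4 * φ n h) :
    ∫⁻ ω, ENNReal.ofReal (φ N fun k => S k ω) ∂P ≤ ENNReal.ofReal (φ 0 fun _ => 0) := by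
  suffices H : ∀ n ≤ N,
      ∫⁻ ω, ENNReal.ofReal (φ n fun k => S k ω) ∂P ≤ ENNReal.ofReal (φ 0 fun _ => 0) from
    H N le_rfl
  intro n
  induction n with
  | zero =>
    intro _
    have : ∀ᵐ ω ∂P, ENNReal.ofReal (φ 0 fun k => S k ω) = ENNReal.ofReal (φ 0 fun _ => 0) := by
      filter_upwards [hS.2.1] with ω h0
      rw [hdep 0 (fun k => S k ω) (fun _ => 0)]
      intro k hk
      obtain rfl : k = 0 := by omega
      exact h0
    rw [lintegral_congr_ae this]
    simp
  | succ n ih =>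
    intro hn
    refine le_trans ?_ (ih (by omega))
    rw [← setLIntegral_univ (μ := P), ← setLIntegral_univ (μ := P), ← iUnion_cyl (S := S) n,
      lintegral_iUnion (fun p => measurableSet_cyl hS.1 n _) (disjoint_cyl n),
      lintegral_iUnion (fun p => measurableSet_cyl hS.1 n _) (disjoint_cyl n)]
    refine ENNReal.tsum_le_tsum fun p => ?_
    set h := extend p with hh
    have hE := measurableSet_cyl (S := S) hS.1 n h
    rcases eq_or_ne (P (cyl S n h)) 0 with h0 | h0
    · simp [Measure.restrict_eq_zero.2 h0]
    have hbox : Box n h := by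
      have : ∃ᵐ ω ∂P, ω ∈ cyl S n h := by
        rwa [frequently_ae_mem_iff]
      obtain ⟨ω, hω, hb⟩ := (this.and_eventually (ae_box hS)).exists
      intro k hk i
      rw [← hω k hk]
      exact hb n k hk i
    have hupd : ∀ i b, Box (n + 1) (Function.update h (n + 1) (h n + step i b)) := by
      intro i b k hk j
      rcases Nat.lt_or_ge n k with h1 | h1
      · obtain rfl : k = n + 1 := by omega
        have h2 := abs_step_le i b j
        have h3 := hbox n le_rfl j
        simp only [Function.update_self, Pi.add_apply]
        push_cast
        exact (abs_add_le _ _).trans (add_le_add h3 h2)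
      · rw [Function.update_of_ne (by omega)]
        exact hbox k h1 j
    have e1 : ∫⁻ ω in cyl S n h, ENNReal.ofReal (φ (n + 1) fun k => S k ω) ∂P =
        ∫⁻ ω in cyl S n h,
          ENNReal.ofReal (φ (n + 1) (Function.update h (n + 1) (S (n + 1) ω))) ∂P := by
      refine setLIntegral_congr_fun hE fun ω hω => ?_
      congr 1
      refine hdep _ _ _ fun k hk => ?_
      rcases Nat.lt_or_ge n k with h1 | h1
      · obtain rfl : k = n + 1 := by omega
        simp
      · rw [Function.update_of_ne (by omega)]
        exact hω k h1
    have e2 : ∫⁻ ω in cyl S n h, ENNReal.ofReal (φ n fun k => S k ω) ∂P =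
        ENNReal.ofReal (φ n h) * P (cyl S n h) := by
      rw [← setLIntegral_const]
      refine setLIntegral_congr_fun hE fun ω hω => ?_
      rw [hdep n _ _ hω]
    rw [e1, e2]
    by_cases hns : ∀ k < n, h n ≠ h k
    · rw [(new_site hS hns).2 fun z =>
          ENNReal.ofReal (φ (n + 1) (Function.update h (n + 1) z)), ← Finset.sum_mul,
        ← ENNReal.ofReal_sum_of_nonneg fun q _ => hnonneg _ hn _ (hupd _ _)]
      calc _ ≤ ENNReal.ofReal (8 * φ n h) * (P (cyl S n h) / 8) := by
            gcongr
            exact hnew n (by omega) h hbox hns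
        _ = _ := by
            rw [ENNReal.ofReal_mul (by norm_num), mul_right_comm, mul_comm]
            congr 1
            norm_num
            exact ENNReal.mul_div_cancel (by norm_num) (by norm_num)
    · push Not at hns
      rw [(old_site hS hns).2 fun z =>
          ENNReal.ofReal (φ (n + 1) (Function.update h (n + 1) z)), ← Finset.sum_mul,
        ← ENNReal.ofReal_sum_of_nonneg fun q _ => hnonneg _ hn _ (hupd _ _)]
      calc _ ≤ ENNReal.ofReal (4 * φ n h) * (P (cyl S n h) / 4) := by
            gcongr
            exact hold n (by omega) h hbox hns
        _ = _ := by
            rw [ENNReal.ofReal_mul (by norm_num), mul_right_comm, mul_comm]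
            congr 1
            norm_num
            exact ENNReal.mul_div_cancel (by norm_num) (by norm_num)

/-- Markov's inequality for the supermartingales of `lintegral_le_of_step`. -/
lemma measure_ge_le (hS : IsBERW 4 4 2 P S) (N : ℕ) (φ : ℕ → (ℕ → Fin 4 → ℤ) → ℝ)
    (hdep : ∀ n h h', (∀ k ≤ n, h k = h' k) → φ n h = φ n h')
    (hnonneg : ∀ n ≤ N, ∀ h, Box n h → 0 ≤ φ n h)
    (hnew : ∀ n < N, ∀ h, Box n h → (∀ k < n, h n ≠ h k) →
      ∑ q : Fin 4 × Bool, φ (n + 1) (Function.update h (n + 1) (h n + step q.1 q.2))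
        ≤ 8 * φ n h)
    (hold : ∀ n < N, ∀ h, Box n h → (∃ k < n, h n = h k) →
      ∑ q : Fin 2 × Bool, φ (n + 1) (Function.update h (n + 1) (h n + step (oldCoord q.1) q.2))
        ≤ 4 * φ n h) {t : ℝ} (ht : 0 < t) :
    P {ω | t ≤ φ N fun k => S k ω} ≤ ENNReal.ofReal ((φ 0 fun _ => 0) / t) := by
  have hmeas : Measurable fun ω => ENNReal.ofReal (φ N fun k => S k ω) := by
    have e : (fun ω => ENNReal.ofReal (φ N fun k => S k ω)) =
        (fun p : Fin (N + 1) → Fin 4 → ℤ => ENNReal.ofReal (φ N (extend p))) ∘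
          fun ω (k : Fin (N + 1)) => S k ω := by
      ext1 ω
      simp only [Function.comp]
      rw [hdep N _ _ (mem_cyl_extend N ω)]
    rw [e]
    exact (Measurable.of_discrete).comp (measurable_pi_lambda _ fun k => hS.1 k)
  calc P {ω | t ≤ φ N fun k => S k ω}
      ≤ P {ω | ENNReal.ofReal t ≤ ENNReal.ofReal (φ N fun k => S k ω)} :=
        measure_mono fun ω hω => ENNReal.ofReal_le_ofReal hω
    _ ≤ (∫⁻ ω, ENNReal.ofReal (φ N fun k => S k ω) ∂P) / ENNReal.ofReal t :=
        meas_ge_le_lintegral_div hmeas.aemeasurable (by simpa using ht) ENNReal.ofReal_ne_top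
    _ ≤ ENNReal.ofReal (φ 0 fun _ => 0) / ENNReal.ofReal t := by
        gcongr
        exact lintegral_le_of_step hS N φ hdep hnonneg hnew hold
    _ = _ := (ENNReal.ofReal_div_of_pos ht).symm

/-- The number of visits of the path `h` to `x` before time `n`. -/
def visits (n : ℕ) (h : ℕ → Fin 4 → ℤ) (x : Fin 4 → ℤ) : ℕ :=
  ((Finset.range n).filter fun j => h j = x).card

lemma visits_congr {n : ℕ} {h h' : ℕ → Fin 4 → ℤ} (hh : ∀ k < n, h k = h' k) (x : Fin 4 → ℤ) :
    visits n h x = visits n h' x := by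
  unfold visits
  congr 1
  refine Finset.filter_congr fun k hk => ?_
  rw [hh k (Finset.mem_range.1 hk)]

lemma visits_succ (n : ℕ) (h : ℕ → Fin 4 → ℤ) (x : Fin 4 → ℤ) :
    visits (n + 1) h x = visits n h x + if h n = x then 1 else 0 := by
  unfold visits
  rw [Finset.range_add_one, Finset.filter_insert]
  split_ifs <;> simp

lemma visits_update_succ (n : ℕ) (h : ℕ → Fin 4 → ℤ) (x z : Fin 4 → ℤ) :
    visits (n + 1) (Function.update h (n + 1) z) x =
      visits n h x + if h n = x then 1 else 0 := by
  rw [← visits_succ]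
  exact visits_congr (fun k hk => Function.update_of_ne (by omega) _ _) x

/-- The function `log (1 + |z|²)` of the last two coordinates, which is subharmonic
for the simple random walk of `ℤ²`. -/
noncomputable def pot (z : Fin 4 → ℤ) : ℝ := Real.log (1 + (z 2 : ℝ) ^ 2 + (z 3 : ℝ) ^ 2)

lemma log_subharmonic (u v : ℝ) :
    4 * Real.log (1 + u ^ 2 + v ^ 2) ≤
      Real.log (1 + (u + 1) ^ 2 + v ^ 2) + Real.log (1 + (u - 1) ^ 2 + v ^ 2) +
        Real.log (1 + u ^ 2 + (v + 1) ^ 2) + Real.log (1 + u ^ 2 + (v - 1) ^ 2) := by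
  rw [← Real.log_mul (by positivity) (by positivity), ← Real.log_mul (by positivity) (by positivity),
    ← Real.log_mul (by positivity) (by positivity)]
  have : 4 * Real.log (1 + u ^ 2 + v ^ 2) = Real.log ((1 + u ^ 2 + v ^ 2) ^ 4) := by
    rw [Real.log_pow]; norm_num
  rw [this]
  refine Real.log_le_log (by positivity) ?_
  have h1 := sq_nonneg (u * v)
  have h2 : 0 ≤ (u ^ 2 + v ^ 2) ^ 2 := by positivity
  have h3 : 0 ≤ u ^ 2 + v ^ 2 := by positivity
  nlinarith

lemma sum_pot_old_zero (z : Fin 4 → ℤ) (h2 : z 2 = 0) (h3 : z 3 = 0) :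
    ∑ q : Fin 2 × Bool, pot (z + step (oldCoord q.1) q.2) = 4 * Real.log 2 := by
  simp [Fintype.sum_prod_type, pot, step, oldCoord, sgn, unitVec, h2, h3]
  norm_num
  ring

lemma sum_pot_old (z : Fin 4 → ℤ) :
    4 * pot z ≤ ∑ q : Fin 2 × Bool, pot (z + step (oldCoord q.1) q.2) := by
  have := log_subharmonic (z 2) (z 3)
  simp [Fintype.sum_prod_type, pot, step, oldCoord, sgn, unitVec, ← sub_eq_add_neg]
  linarith

lemma sum_pot_new (z : Fin 4 → ℤ) :
    ∑ q : Fin 4 × Bool, pot (z + step q.1 q.2) =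
      4 * pot z + ∑ q : Fin 2 × Bool, pot (z + step (oldCoord q.1) q.2) := by
  simp [Fintype.sum_prod_type, Fin.sum_univ_four, pot, step, oldCoord, sgn, unitVec]
  ring

lemma pot_nonneg (z : Fin 4 → ℤ) : 0 ≤ pot z :=
  Real.log_nonneg (by nlinarith [sq_nonneg (z 2 : ℝ), sq_nonneg (z 3 : ℝ)])

lemma pot_le {n : ℕ} {z : Fin 4 → ℤ} (h : ∀ i, |z i| ≤ (n : ℤ)) :
    pot z ≤ Real.log (1 + 2 * (n : ℝ) ^ 2) := by
  have key : ∀ i, (z i : ℝ) ^ 2 ≤ (n : ℝ) ^ 2 := fun i => by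
    have h1 := h i
    rw [← sq_abs (z i : ℝ)]
    have : |(z i : ℝ)| ≤ n := by exact_mod_cast h1
    gcongr
  refine Real.log_le_log (by positivity) ?_
  linarith [key 2, key 3]

/-- The walk visits a given site at most `T` times before time `N`, up to probability
exponentially small in `T / log N`. -/
lemma measure_visits_le (hS : IsBERW 4 4 2 P S) {N : ℕ} (hN : 1 ≤ N) (x : Fin 4 → ℤ)
    (hx : ∀ i, |x i| ≤ (N : ℤ)) (T : ℝ) :
    P {ω | T ≤ visits N (fun k => S k ω) x} ≤
      ENNReal.ofReal
        (2 * Real.exp (-(Real.log 2 / (4 * Real.log (1 + 8 * (N : ℝ) ^ 2)) * T))) := by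
  set B : ℝ := Real.log (1 + 8 * (N : ℝ) ^ 2) with hB
  have hN' : (1 : ℝ) ≤ N := by exact_mod_cast hN
  have hBpos : 0 < B := Real.log_pos (by nlinarith)
  have hl2 : 0 < Real.log 2 := Real.log_pos (by norm_num)
  set θ : ℝ := Real.log 2 / (4 * B) with hθ
  have hθpos : 0 < θ := by positivity
  have hθB : θ * (4 * B) = Real.log 2 := by rw [hθ]; field_simp
  have hexp : Real.exp θ * (1 - θ) ≤ 1 := by
    have h1 : 1 - θ ≤ Real.exp (-θ) := by linarith [Real.add_one_le_exp (-θ)]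
    calc Real.exp θ * (1 - θ) ≤ Real.exp θ * Real.exp (-θ) := by gcongr
      _ = 1 := by rw [← Real.exp_add]; simp
  have hexp1 : 1 ≤ Real.exp θ := Real.one_le_exp hθpos.le
  let φ : ℕ → (ℕ → Fin 4 → ℤ) → ℝ := fun n h =>
    Real.exp (θ * visits n h x) * (2 * B - pot (h n - x))
  have hpot : ∀ n ≤ N, ∀ h, Box n h → pot (h n - x) ≤ B := by
    intro n hn h hb
    have : ∀ i, |(h n - x) i| ≤ ((2 * N : ℕ) : ℤ) := by
      intro i
      have h1 := hb n le_rfl i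
      have h2 := hx i
      have h3 := abs_sub (h n i) (x i)
      rw [Pi.sub_apply]
      push_cast
      have h4 : (n : ℤ) ≤ N := by exact_mod_cast hn
      linarith
    refine (pot_le this).trans_eq ?_
    rw [hB]
    push_cast
    ring_nf
  have hdep : ∀ n h h', (∀ k ≤ n, h k = h' k) → φ n h = φ n h' := by
    intro n h h' hh
    simp only [φ]
    rw [visits_congr (fun k hk => hh k hk.le), hh n le_rfl]
  have hlow : ∀ n ≤ N, ∀ h, Box n h → Real.exp (θ * visits n h x) * B ≤ φ n h := by
    intro n hn h hb
    have := hpot n hn h hb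
    simp only [φ]
    gcongr
    linarith
  have hnonneg : ∀ n ≤ N, ∀ h, Box n h → 0 ≤ φ n h := fun n hn h hb =>
    le_trans (by positivity) (hlow n hn h hb)
  have hval : ∀ n h z, φ (n + 1) (Function.update h (n + 1) (h n + z)) =
      Real.exp (θ * visits n h x) *
        ((if h n = x then Real.exp θ else 1) * (2 * B - pot (h n - x + z))) := by
    intro n h z
    simp only [φ]
    rw [visits_update_succ, Function.update_self, ← mul_assoc, add_sub_right_comm]
    split_ifs <;> simp [mul_add, Real.exp_add]
  have hzero : pot 0 = 0 := by simp [pot]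
  have hnew : ∀ n < N, ∀ h, Box n h → (∀ k < n, h n ≠ h k) →
      ∑ q : Fin 4 × Bool, φ (n + 1) (Function.update h (n + 1) (h n + step q.1 q.2))
        ≤ 8 * φ n h := by
    intro n _ h _ _
    simp only [hval, ← Finset.mul_sum]
    simp only [φ]
    rw [mul_left_comm (8 : ℝ)]
    refine mul_le_mul_of_nonneg_left ?_ (Real.exp_pos _).le
    rw [Finset.sum_sub_distrib, sum_pot_new]
    split_ifs with hc
    · rw [sum_pot_old_zero _ (by simp [hc]) (by simp [hc]), hc, sub_self, hzero]
      simp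
      nlinarith
    · have := sum_pot_old (h n - x)
      simp
      linarith
  have hold : ∀ n < N, ∀ h, Box n h → (∃ k < n, h n = h k) →
      ∑ q : Fin 2 × Bool, φ (n + 1) (Function.update h (n + 1) (h n + step (oldCoord q.1) q.2))
        ≤ 4 * φ n h := by
    intro n _ h _ _
    simp only [hval, ← Finset.mul_sum]
    simp only [φ]
    rw [mul_left_comm (4 : ℝ)]
    refine mul_le_mul_of_nonneg_left ?_ (Real.exp_pos _).le
    rw [Finset.sum_sub_distrib]
    split_ifs with hc
    · rw [sum_pot_old_zero _ (by simp [hc]) (by simp [hc]), hc, sub_self, hzero]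
      simp
      nlinarith
    · have := sum_pot_old (h n - x)
      simp
      linarith
  have h0 : (φ 0 fun _ => 0) ≤ 2 * B := by
    simp [φ, visits, pot_nonneg]
  have hmain := measure_ge_le hS N φ hdep hnonneg hnew hold
    (t := Real.exp (θ * T) * B) (by positivity)
  calc P {ω | T ≤ visits N (fun k => S k ω) x}
      ≤ P {ω | Real.exp (θ * T) * B ≤ φ N fun k => S k ω} := by
        refine measure_mono_ae ?_
        filter_upwards [ae_box hS] with ω hb hω
        refine le_trans ?_ (hlow N le_rfl _ (hb N))
        have hω' : T ≤ visits N (fun k => S k ω) x := hω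
        gcongr
    _ ≤ _ := hmain
    _ ≤ _ := by
        refine ENNReal.ofReal_le_ofReal ?_
        rw [div_le_iff₀ (by positivity)]
        refine h0.trans_eq ?_
        rw [Real.exp_neg]
        field_simp

/-- The indicator that the path `h` jumps in the first two coordinates at time `k`. -/
def XJump (h : ℕ → Fin 4 → ℤ) (k : ℕ) : Prop := ∃ i : Fin 4, i.1 < 2 ∧ h (k + 1) i ≠ h k i

open scoped Classical in
/-- The weight of the jump at time `k`: `1` at old sites, `u` or `v` at new sites according to
the coordinates used. -/
noncomputable def weight (u v : ℝ) (h : ℕ → Fin 4 → ℤ) (k : ℕ) : ℝ :=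
  if ∀ j < k, h k ≠ h j then if XJump h k then u else v else 1

lemma weight_congr (u v : ℝ) {h h' : ℕ → Fin 4 → ℤ} {k : ℕ} (hh : ∀ j ≤ k + 1, h j = h' j) :
    weight u v h k = weight u v h' k := by
  have h1 : (∀ j < k, h k ≠ h j) ↔ ∀ j < k, h' k ≠ h' j := by
    refine forall₂_congr fun j hj => ?_
    rw [hh k (by omega), hh j (by omega)]
  have h2 : XJump h k ↔ XJump h' k := by
    unfold XJump
    rw [hh k (by omega), hh (k + 1) le_rfl]
  classical exact if_congr h1 (if_congr h2 rfl rfl) rfl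

lemma weight_pos {u v : ℝ} (hu : 0 < u) (hv : 0 < v) (h : ℕ → Fin 4 → ℤ) (k : ℕ) :
    0 < weight u v h k := by
  unfold weight
  split_ifs <;> norm_num [hu, hv]

lemma xJump_update (h : ℕ → Fin 4 → ℤ) (n : ℕ) (i : Fin 4) (b : Bool) :
    XJump (Function.update h (n + 1) (h n + step i b)) n ↔ i.1 < 2 := by
  have : ∀ i b, (∃ j : Fin 4, j.1 < 2 ∧ step i b j ≠ 0) ↔ i.1 < 2 := by decide
  rw [← this i b]
  simp [XJump]

/-- The product of the weights has mean at most one when the two weights average to one. -/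
lemma measure_prod_weight_le (hS : IsBERW 4 4 2 P S) {u v : ℝ} (hu : 0 < u) (hv : 0 < v)
    (huv : u + v = 2) (N : ℕ) {t : ℝ} (ht : 0 < t) :
    P {ω | t ≤ ∏ k ∈ Finset.range N, weight u v (fun k => S k ω) k} ≤
      ENNReal.ofReal (1 / t) := by
  have hval : ∀ n h z,
      ∏ k ∈ Finset.range (n + 1), weight u v (Function.update h (n + 1) z) k =
        (∏ k ∈ Finset.range n, weight u v h k) * weight u v (Function.update h (n + 1) z) n := by
    intro n h z
    rw [Finset.prod_range_succ]
    congr 1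
    refine Finset.prod_congr rfl fun k hk => weight_congr u v fun j hj => ?_
    have := Finset.mem_range.1 hk
    exact Function.update_of_ne (by omega) _ _
  have hsite : ∀ n (h : ℕ → Fin 4 → ℤ) z,
      (∀ j < n, Function.update h (n + 1) z n ≠ Function.update h (n + 1) z j) ↔
        ∀ j < n, h n ≠ h j := by
    intro n h z
    refine forall₂_congr fun j hj => ?_
    rw [Function.update_of_ne (by omega), Function.update_of_ne (by omega)]
  have := measure_ge_le hS N (fun n h => ∏ k ∈ Finset.range n, weight u v h k) ?_ ?_ ?_ ?_ ht
  · simpa using this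
  · intro n h h' hh
    refine Finset.prod_congr rfl fun k hk => weight_congr u v fun j hj => hh j ?_
    have := Finset.mem_range.1 hk
    omega
  · intro n _ h _
    exact Finset.prod_nonneg fun k _ => (weight_pos hu hv h k).le
  · intro n _ h _ hn
    simp only [hval, ← Finset.mul_sum]
    rw [mul_comm]
    refine mul_le_mul_of_nonneg_right ?_
      (Finset.prod_nonneg fun k _ => (weight_pos hu hv h k).le)
    simp only [weight, hsite, xJump_update, if_pos hn]
    simp [Fintype.sum_prod_type, Fin.sum_univ_four]
    linarith
  · intro n _ h _ hn
    have hn' : ¬ ∀ j < n, h n ≠ h j := by push Not; exact hn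
    have hw : ∀ z, weight u v (Function.update h (n + 1) z) n = 1 := fun z =>
      if_neg (by rwa [hsite])
    simp [hval, hw]

open scoped Classical in
lemma prod_weight_eq (u v : ℝ) (h : ℕ → Fin 4 → ℤ) (N : ℕ) :
    ∏ k ∈ Finset.range N, weight u v h k =
      u ^ ((Finset.range N).filter fun k => (∀ j < k, h k ≠ h j) ∧ XJump h k).card *
      v ^ ((Finset.range N).filter fun k => (∀ j < k, h k ≠ h j) ∧ ¬ XJump h k).card := by
  rw [← Finset.prod_const, ← Finset.prod_const, Finset.prod_filter, Finset.prod_filter,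
    ← Finset.prod_mul_distrib]
  refine Finset.prod_congr rfl fun k _ => ?_
  unfold weight
  by_cases h1 : ∀ j < k, h k ≠ h j <;> by_cases h2 : XJump h k <;> simp [h1, h2]

open scoped Classical in
lemma rangeCard_eq (n : ℕ) (ω : Ω) :
    rangeCard S n ω = ((Finset.range (n + 1)).filter fun k => ∀ j < k, S k ω ≠ S j ω).card := by
  unfold rangeCard
  induction n with
  | zero => simp [Finset.filter_singleton]
  | succ n ih =>
    rw [Finset.range_add_one, Finset.image_insert, Finset.filter_insert]
    by_cases hc : ∀ j < n + 1, S (n + 1) ω ≠ S j ω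
    · rw [if_pos hc, Finset.card_insert_of_notMem, Finset.card_insert_of_notMem (by simp), ih]
      simp only [Finset.mem_image, Finset.mem_range, not_exists, not_and]
      exact fun j hj he => hc j hj he.symm
    · rw [if_neg hc, Finset.insert_eq_of_mem, ih]
      push Not at hc
      obtain ⟨j, hj, he⟩ := hc
      exact Finset.mem_image.2 ⟨j, Finset.mem_range.2 hj, he.symm⟩

lemma rangeCard_le (n : ℕ) (ω : Ω) : rangeCard S n ω ≤ n + 1 :=
  Finset.card_image_le.trans (by simp)

open scoped Classical in
lemma newXJumps_le (n : ℕ) (ω : Ω) : newXJumps S n ω ≤ rangeCard S n ω := by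
  rw [rangeCard_eq]
  exact Finset.card_le_card fun k => by simp +contextual

open scoped Classical in
lemma newYJumps_eq (n : ℕ) (ω : Ω) :
    newYJumps S n ω = ((Finset.range (n + 1)).filter fun k =>
      (∀ j < k, S k ω ≠ S j ω) ∧ ¬ XJump (fun k => S k ω) k).card := by
  rw [newYJumps, rangeCard_eq, newXJumps, ← Finset.filter_filter, ← Finset.filter_filter,
    ← Finset.card_filter_add_card_filter_not (s := Finset.filter _ (Finset.range (n + 1)))
      (p := fun k => ∃ i : Fin 4, i.1 < 2 ∧ S (k + 1) ω i ≠ S k ω i), Nat.add_sub_cancel_left]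
  unfold XJump
  congr!

lemma prod_weight_eq_jumps (u v : ℝ) (n : ℕ) (ω : Ω) :
    ∏ k ∈ Finset.range (n + 1), weight u v (fun k => S k ω) k =
      u ^ newXJumps S n ω * v ^ newYJumps S n ω := by
  rw [prod_weight_eq, newYJumps_eq]
  unfold newXJumps XJump
  congr!

lemma pow_le_of_unbalanced {a b : ℕ} (hab : 10 * a ≤ a + b) :
    (6 / 5 : ℝ) ^ (a + b) ≤ (1 / 2) ^ a * (3 / 2) ^ b := by
  obtain ⟨c, rfl⟩ : ∃ c, b = 9 * a + c := ⟨b - 9 * a, by omega⟩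
  have e1 : (6 / 5 : ℝ) ^ (a + (9 * a + c)) = ((6 / 5) ^ 10) ^ a * (6 / 5) ^ c := by
    rw [← pow_mul, ← pow_add]; congr 1; ring
  have e2 : (1 / 2 : ℝ) ^ a * (3 / 2) ^ (9 * a + c) =
      ((1 / 2) * (3 / 2) ^ 9) ^ a * (3 / 2) ^ c := by
    rw [mul_pow, ← pow_mul, pow_add]; ring
  rw [e1, e2]
  exact mul_le_mul (pow_le_pow_left₀ (by norm_num) (by norm_num) _)
    (pow_le_pow_left₀ (by norm_num) (by norm_num) _) (by positivity) (by positivity)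

/-- A large range with few jumps of one of the two kinds at new sites is unlikely. -/
lemma measure_unbalanced_le (hS : IsBERW 4 4 2 P S) (n : ℕ) (m : ℝ) :
    P {ω | m ≤ rangeCard S n ω ∧ (10 * newXJumps S n ω ≤ rangeCard S n ω ∨
        10 * newYJumps S n ω ≤ rangeCard S n ω)} ≤
      ENNReal.ofReal (2 * Real.exp (-(Real.log (6 / 5) * m))) := by
  have hl : 0 < Real.log (6 / 5) := Real.log_pos (by norm_num)
  have hpow : ∀ r : ℕ, m ≤ r → Real.exp (Real.log (6 / 5) * m) ≤ (6 / 5) ^ r := by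
    intro r hr
    rw [← Real.rpow_natCast, Real.rpow_def_of_pos (by norm_num)]
    gcongr
  have hsum : ∀ ω, newXJumps S n ω + newYJumps S n ω = rangeCard S n ω := fun ω => by
    have := newXJumps_le (S := S) n ω
    rw [newYJumps]
    omega
  have h1 := measure_prod_weight_le hS (u := 1 / 2) (v := 3 / 2) (by norm_num) (by norm_num)
    (by norm_num) (n + 1) (Real.exp_pos (Real.log (6 / 5) * m))
  have h2 := measure_prod_weight_le hS (u := 3 / 2) (v := 1 / 2) (by norm_num) (by norm_num)
    (by norm_num) (n + 1) (Real.exp_pos (Real.log (6 / 5) * m))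
  simp only [prod_weight_eq_jumps] at h1 h2
  rw [one_div (Real.exp _), ← Real.exp_neg] at h1 h2
  rw [two_mul, ENNReal.ofReal_add (Real.exp_pos _).le (Real.exp_pos _).le]
  refine le_trans (le_trans (measure_mono ?_) (measure_union_le _ _)) (add_le_add h1 h2)
  rintro ω ⟨hm, hω | hω⟩
  · left
    refine (hpow _ hm).trans ?_
    rw [← hsum] at hω ⊢
    exact pow_le_of_unbalanced hω
  · right
    refine (hpow _ hm).trans ?_
    rw [← hsum] at hω ⊢
    change _ ≤ (3 / 2 : ℝ) ^ _ * (1 / 2) ^ _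
    rw [add_comm] at hω ⊢
    rw [mul_comm]
    exact pow_le_of_unbalanced hω

/-- The range at time `n` is at least `n / T`, up to polynomial factors times the probability
of visiting a given site `T` times. -/
lemma measure_small_range_le (hS : IsBERW 4 4 2 P S) (n : ℕ) (T : ℝ) :
    P {ω | rangeCard S n ω * T < n} ≤
      ENNReal.ofReal ((2 * n + 3) ^ 4 *
        (2 * Real.exp (-(Real.log 2 / (4 * Real.log (1 + 8 * ((n : ℝ) + 1) ^ 2)) * T)))) := by
  let D : Finset (Fin 4 → ℤ) :=
    Fintype.piFinset fun _ => Finset.Icc (-((n + 1 : ℕ) : ℤ)) ((n + 1 : ℕ) : ℤ)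
  have hD : (D.card : ENNReal) = ENNReal.ofReal ((2 * n + 3) ^ 4) := by
    have h1 : D.card = (2 * n + 3) ^ 4 := by
      simp only [D, Fintype.card_piFinset, Int.card_Icc, Finset.prod_const, Finset.card_univ,
        Fintype.card_fin]
      congr 1
      omega
    rw [h1, ← ENNReal.ofReal_natCast]
    push_cast
    rfl
  rw [ENNReal.ofReal_mul (by positivity), ← hD, ← nsmul_eq_mul, ← Finset.sum_const]
  refine le_trans ?_ ((measure_biUnion_finset_le (μ := P) D
    fun x => {ω | T ≤ visits (n + 1) (fun k => S k ω) x}).trans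
      (Finset.sum_le_sum fun x hx => ?_))
  · refine measure_mono_ae ?_
    filter_upwards [ae_box hS] with ω hb hω
    by_contra hcon
    have hlt : ∀ x ∈ D, (visits (n + 1) (fun k => S k ω) x : ℝ) < T := by
      intro x hx
      by_contra hT
      exact hcon (Set.mem_biUnion hx (not_lt.1 hT))
    have hcard := Finset.card_eq_sum_card_image (fun k => S k ω) (Finset.range (n + 1))
    have hle : ((n : ℝ) + 1) ≤ rangeCard S n ω * T := by
      calc (n : ℝ) + 1 = ((Finset.range (n + 1)).card : ℝ) := by simp
        _ = ∑ x ∈ (Finset.range (n + 1)).image fun k => S k ω,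
              (visits (n + 1) (fun k => S k ω) x : ℝ) := by
            rw [hcard]; push_cast; rfl
        _ ≤ ∑ x ∈ (Finset.range (n + 1)).image fun k => S k ω, T := by
            refine Finset.sum_le_sum fun x hx => (hlt x ?_).le
            obtain ⟨k, hk, rfl⟩ := Finset.mem_image.1 hx
            have hk' := Finset.mem_range.1 hk
            refine Fintype.mem_piFinset.2 fun i => Finset.mem_Icc.2 (abs_le.1 ?_)
            have h1 : |S k ω i| ≤ (k : ℤ) := hb k k le_rfl i
            push_cast
            omega
        _ = _ := by rw [Finset.sum_const, nsmul_eq_mul]; rfl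
    have hω' : rangeCard S n ω * T < n := hω
    linarith
  · have := measure_visits_le hS (N := n + 1) (by omega) x
      (fun i => abs_le.2 (Finset.mem_Icc.1 (Fintype.mem_piFinset.1 hx i))) T
    exact_mod_cast this

/-- Outside an event of small probability the range is large and the jumps of both kinds at new
sites are balanced, whence the estimates on their numbers. -/
lemma measure_bad_le (hS : IsBERW 4 4 2 P S) {n : ℕ} (hn : 10 ≤ n) {T : ℝ} (hT : 0 < T) :
    P {ω | ¬ ((n / (10 * T) ≤ newXJumps S n ω ∧ (newXJumps S n ω : ℝ) ≤ 99 * n / 100) ∧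
        (n / (10 * T) ≤ newYJumps S n ω ∧ (newYJumps S n ω : ℝ) ≤ 99 * n / 100))} ≤
      ENNReal.ofReal ((2 * n + 3) ^ 4 *
        (2 * Real.exp (-(Real.log 2 / (4 * Real.log (1 + 8 * ((n : ℝ) + 1) ^ 2)) * T))) +
        2 * Real.exp (-(Real.log (6 / 5) * (n / T)))) := by
  rw [ENNReal.ofReal_add (by positivity) (by positivity)]
  refine le_trans (le_trans (measure_mono ?_) (measure_union_le _ _))
    (add_le_add (measure_small_range_le hS n T) (measure_unbalanced_le hS n (n / T)))
  intro ω hω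
  by_contra hcon
  refine hω ?_
  simp only [Set.mem_union, Set.mem_ofPred_eq, not_or, not_lt, not_and, not_le] at hcon
  obtain ⟨h1, h2⟩ := hcon
  have hm : n / T ≤ rangeCard S n ω := by rwa [div_le_iff₀ hT]
  obtain ⟨hX, hY⟩ := h2 hm
  have hsum : newXJumps S n ω + newYJumps S n ω = rangeCard S n ω := by
    have := newXJumps_le (S := S) n ω
    rw [newYJumps]
    omega
  have hR := rangeCard_le (S := S) n ω
  have hm' : n / (10 * T) = n / T / 10 := by rw [mul_comm, div_mul_eq_div_div]
  rw [hm']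
  rify at hX hY hsum hR hn
  refine ⟨⟨?_, ?_⟩, ?_, ?_⟩ <;> linarith

end

lemma eventually_error_le {M : ℝ} (hM : 0 < M) {K : ℝ} (hK : K = 12 * (M + 5) / Real.log 2) :
    ∀ᶠ n : ℕ in atTop, (2 * (n : ℝ) + 3) ^ 4 *
        (2 * Real.exp (-(Real.log 2 / (4 * Real.log (1 + 8 * ((n : ℝ) + 1) ^ 2)) *
          (K * Real.log n ^ 2)))) +
        2 * Real.exp (-(Real.log (6 / 5) * (n / (K * Real.log n ^ 2)))) ≤
      164 * (n : ℝ) ^ (-(M + 1)) := by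
  have hl2 : 0 < Real.log 2 := Real.log_pos (by norm_num)
  have hl6 : 0 < Real.log (6 / 5) := Real.log_pos (by norm_num)
  have hKpos : 0 < K := by rw [hK]; positivity
  have hlog := (Real.isLittleO_pow_log_id_atTop (n := 3)).bound
    (c := Real.log (6 / 5) / (K * (M + 1))) (by positivity)
  filter_upwards [tendsto_natCast_atTop_atTop.eventually hlog, eventually_ge_atTop 10]
    with n h3 hn
  have hn' : (10 : ℝ) ≤ n := by exact_mod_cast hn
  have hn0 : (0 : ℝ) < n := by linarith
  have hL : 0 < Real.log n := Real.log_pos (by linarith)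
  have hpow : ∀ a : ℝ, Real.exp (-(a * Real.log n)) = (n : ℝ) ^ (-a) := fun a => by
    rw [Real.rpow_def_of_pos hn0]
    congr 1
    ring
  have hB : Real.log (1 + 8 * ((n : ℝ) + 1) ^ 2) ≤ 3 * Real.log n := by
    have : 3 * Real.log n = Real.log ((n : ℝ) ^ 3) := by rw [Real.log_pow]; norm_num
    rw [this]
    refine Real.log_le_log (by positivity) ?_
    nlinarith [mul_nonneg (sq_nonneg (n : ℝ)) (sub_nonneg.2 hn'), mul_self_nonneg (n : ℝ)]
  have hBpos : 0 < Real.log (1 + 8 * ((n : ℝ) + 1) ^ 2) := Real.log_pos (by nlinarith)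
  have e1 : Real.exp (-(Real.log 2 / (4 * Real.log (1 + 8 * ((n : ℝ) + 1) ^ 2)) *
      (K * Real.log n ^ 2))) ≤ (n : ℝ) ^ (-(M + 5)) := by
    rw [← hpow]
    refine Real.exp_le_exp.2 (neg_le_neg ?_)
    calc (M + 5) * Real.log n
        = Real.log 2 / (4 * (3 * Real.log n)) * (K * Real.log n ^ 2) := by
          rw [hK]; field_simp; ring
      _ ≤ _ := by gcongr
  have e2 : Real.exp (-(Real.log (6 / 5) * (n / (K * Real.log n ^ 2)))) ≤
      (n : ℝ) ^ (-(M + 1)) := by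
    rw [← hpow]
    refine Real.exp_le_exp.2 (neg_le_neg ?_)
    simp only [id, Real.norm_eq_abs, abs_of_pos hn0, abs_of_pos (pow_pos hL 3)] at h3
    rw [← mul_div_assoc, le_div_iff₀ (by positivity)]
    calc (M + 1) * Real.log n * (K * Real.log n ^ 2)
        = Real.log n ^ 3 * (K * (M + 1)) := by ring
      _ ≤ Real.log (6 / 5) / (K * (M + 1)) * n * (K * (M + 1)) := by gcongr
      _ = _ := by field_simp
  have e3 : (2 * (n : ℝ) + 3) ^ 4 ≤ 81 * (n : ℝ) ^ 4 := by
    calc (2 * (n : ℝ) + 3) ^ 4 ≤ (3 * n) ^ 4 := by gcongr; linarith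
      _ = _ := by ring
  have e4 : (n : ℝ) ^ 4 * (n : ℝ) ^ (-(M + 5)) = (n : ℝ) ^ (-(M + 1)) := by
    rw [← Real.rpow_natCast, ← Real.rpow_add hn0]
    congr 1
    push_cast
    ring
  calc _ ≤ 81 * (n : ℝ) ^ 4 * (2 * (n : ℝ) ^ (-(M + 5))) + 2 * (n : ℝ) ^ (-(M + 1)) := by gcongr
    _ = 162 * ((n : ℝ) ^ 4 * (n : ℝ) ^ (-(M + 5))) + 2 * (n : ℝ) ^ (-(M + 1)) := by ring
    _ = _ := by rw [e4]; ring

lemma isLittleO_of_measure_compl_le {Ω : Type*} [MeasurableSpace Ω] (P : Measure Ω)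
    [IsProbabilityMeasure P] (A : ℕ → Set Ω) {M c : ℝ} (hc : 0 ≤ c)
    (h : ∀ᶠ n : ℕ in atTop, P (A n)ᶜ ≤ ENNReal.ofReal (c * (n : ℝ) ^ (-(M + 1)))) :
    (fun n => 1 - (P (A n)).toReal) =o[atTop] fun n : ℕ => (n : ℝ) ^ (-M) := by
  have hO : (fun n => 1 - (P (A n)).toReal) =O[atTop] fun n : ℕ => (n : ℝ) ^ (-(M + 1)) := by
    refine Asymptotics.IsBigO.of_bound c ?_
    filter_upwards [h] with n hn
    have h1 : 1 ≤ P.real (A n) + P.real (A n)ᶜ := by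
      have := measureReal_union_le (μ := P) (A n) (A n)ᶜ
      rwa [Set.union_compl_self, probReal_univ] at this
    have h2 : P.real (A n) ≤ 1 := measureReal_le_one
    have h3 : P.real (A n)ᶜ ≤ c * (n : ℝ) ^ (-(M + 1)) :=
      ENNReal.toReal_le_of_le_ofReal (by positivity) hn
    change ‖1 - P.real (A n)‖ ≤ _
    rw [Real.norm_of_nonneg (by linarith), Real.norm_of_nonneg (by positivity)]
    linarith
  refine hO.trans_isLittleO ?_
  refine Asymptotics.isLittleO_of_tendsto' ?_
    ((tendsto_inv_atTop_nhds_zero_nat (𝕜 := ℝ)).congr' ?_)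
  · filter_upwards [eventually_gt_atTop 0] with n hn h0
    have hn0 : (0 : ℝ) < n := by exact_mod_cast hn
    exact absurd h0 (Real.rpow_pos_of_pos hn0 _).ne'
  · filter_upwards [eventually_gt_atTop 0] with n hn
    have hn0 : (0 : ℝ) < n := by exact_mod_cast hn
    rw [← Real.rpow_sub hn0, ← Real.rpow_neg_one]
    congr 1
    ring

end BERW

/-- For the `M₄(4,2)` balanced excited random walk, for every `M > 0` and each
`i ∈ {1,2}` there is a constant `C > 0` such that
`P[n/(C log n)² ≤ r_n^{(i)} ≤ 99n/100] = 1 − o(n^{−M})`. -/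
theorem berw_M4_4_2_range_estimate {Ω : Type*} [MeasurableSpace Ω]
    (P : Measure Ω) [IsProbabilityMeasure P]
    (S : ℕ → Ω → Fin 4 → ℤ) (hS : IsBERW 4 4 2 P S) (M : ℝ) (hM : 0 < M) :
    (∃ C : ℝ, 0 < C ∧
      (fun n : ℕ => 1 - (P {ω | (n : ℝ) / (C * Real.log n) ^ 2 ≤ newXJumps S n ω ∧
          (newXJumps S n ω : ℝ) ≤ 99 * n / 100}).toReal)
        =o[atTop] fun n : ℕ => (n : ℝ) ^ (-M)) ∧
    (∃ C : ℝ, 0 < C ∧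
      (fun n : ℕ => 1 - (P {ω | (n : ℝ) / (C * Real.log n) ^ 2 ≤ newYJumps S n ω ∧
          (newYJumps S n ω : ℝ) ≤ 99 * n / 100}).toReal)
        =o[atTop] fun n : ℕ => (n : ℝ) ^ (-M)) := by
  obtain ⟨K, hK⟩ : ∃ K, K = 12 * (M + 5) / Real.log 2 := ⟨_, rfl⟩
  have hKpos : 0 < K := by
    have : 0 < Real.log 2 := Real.log_pos (by norm_num)
    rw [hK]
    positivity
  have hC : ∀ n : ℕ, (Real.sqrt (10 * K) * Real.log n) ^ 2 = 10 * (K * Real.log n ^ 2) := by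
    intro n
    rw [mul_pow, Real.sq_sqrt (by positivity), mul_assoc]
  have hbad := (BERW.eventually_error_le hM hK).and (eventually_ge_atTop 10)
  have hlog : ∀ n : ℕ, 10 ≤ n → 0 < K * Real.log n ^ 2 := fun n hn => by
    have : 0 < Real.log n := Real.log_pos (by norm_cast; omega)
    positivity
  refine ⟨⟨Real.sqrt (10 * K), by positivity, ?_⟩, Real.sqrt (10 * K), by positivity, ?_⟩
  · refine BERW.isLittleO_of_measure_compl_le P _ (c := 164) (by norm_num) ?_
    filter_upwards [hbad] with n ⟨herr, hn⟩
    refine le_trans (measure_mono ?_)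
      ((BERW.measure_bad_le hS hn (hlog n hn)).trans (ENNReal.ofReal_le_ofReal herr))
    intro ω hω hg
    refine hω ?_
    rw [Set.mem_ofPred_eq, hC]
    exact hg.1
  · refine BERW.isLittleO_of_measure_compl_le P _ (c := 164) (by norm_num) ?_
    filter_upwards [hbad] with n ⟨herr, hn⟩
    refine le_trans (measure_mono ?_)
      ((BERW.measure_bad_le hS hn (hlog n hn)).trans (ENNReal.ofReal_le_ofReal herr))
    intro ω hω hg
    refine hω ?_
    rw [Set.mem_ofPred_eq, hC]
    exact hg.2
end

section
/- Let (S_n) be the M₄(4,2) balanced excited random walk. Then there exists a constant C > 0 such that for every n > 1, P[ 0 ∈ {S_n, S_{n+1},…, S_{2n}} ] ≤ C·((log log n)/(log n))². Consequently ∑_{k=0}^∞ P[ 0 ∈ {S_{2^k},…, S_{2^{k+1}}} ] < ∞, and by Borel–Cantelli the M₄(4,2)-random walk is transient; the same conclusions hold for the M₄(2,4)-random walk. -/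
open MeasureTheory Filter

namespace BERW

/-- The heat kernel of the simple random walk on `ℤ`. -/
noncomputable def lineKernel : ℕ → ℤ → ℝ
  | 0, z => if z = 0 then 1 else 0
  | m + 1, z => (lineKernel m (z + 1) + lineKernel m (z - 1)) / 2

lemma lineKernel_nonneg (m : ℕ) (z : ℤ) : 0 ≤ lineKernel m z := by
  induction m generalizing z with
  | zero => unfold lineKernel; split_ifs <;> norm_num
  | succ m ih => unfold lineKernel; linarith [ih (z + 1), ih (z - 1)]

lemma lineKernel_eq_zero_of_lt (m : ℕ) (z : ℤ) (hz : z < -m) : lineKernel m z = 0 := by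
  induction m generalizing z with
  | zero => unfold lineKernel; rw [if_neg]; push_cast at hz; omega
  | succ m ih =>
    unfold lineKernel
    push_cast at hz
    rw [ih _ (by omega), ih _ (by omega)]; norm_num

lemma lineKernel_eq_zero_of_odd (m : ℕ) (z : ℤ) (hz : Odd (z + m)) : lineKernel m z = 0 := by
  induction m generalizing z with
  | zero => unfold lineKernel; rw [if_neg]; rintro rfl; simp at hz
  | succ m ih =>
    unfold lineKernel
    obtain ⟨k, hk⟩ := hz
    push_cast at hk
    rw [ih _ ⟨k, by omega⟩, ih _ ⟨k - 1, by omega⟩]; norm_num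

lemma lineKernel_eq_choose (m j : ℕ) : lineKernel m (2 * j - m) = m.choose j / 2 ^ m := by
  induction m generalizing j with
  | zero =>
    unfold lineKernel
    rcases j with _ | j
    · simp
    · rw [if_neg (by push_cast; omega)]; simp
  | succ m ih =>
    unfold lineKernel
    have h1 : (2 * j - ((m + 1 : ℕ) : ℤ) + 1 : ℤ) = 2 * j - m := by push_cast; ring
    rw [h1, ih]
    rcases j with _ | j
    · rw [lineKernel_eq_zero_of_lt _ _ (by push_cast; omega)]
      simp [pow_succ]
      ring
    · have h2 : (2 * (j + 1 : ℕ) - ((m + 1 : ℕ) : ℤ) - 1 : ℤ) = 2 * j - m := by push_cast; ring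
      rw [h2, ih, Nat.choose_succ_succ]
      push_cast
      rw [pow_succ]
      field_simp
      ring

lemma lineKernel_two_mul_zero (m : ℕ) : lineKernel (2 * m) 0 = m.centralBinom / 4 ^ m := by
  have h := lineKernel_eq_choose (2 * m) m
  push_cast at h
  rw [sub_self] at h
  rw [h, Nat.centralBinom, pow_mul]
  norm_num

lemma lineKernel_two_mul_le (m : ℕ) (z : ℤ) : lineKernel (2 * m) z ≤ m.centralBinom / 4 ^ m := by
  have hpos : (0 : ℝ) ≤ m.centralBinom / 4 ^ m := by positivity
  rcases Int.even_or_odd (z + (2 * m : ℕ)) with he | ho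
  · rcases lt_or_ge z (-(2 * m : ℕ)) with hz | hz
    · rw [lineKernel_eq_zero_of_lt _ _ hz]; exact hpos
    · obtain ⟨k, hk⟩ := he
      have hk0 : 0 ≤ k := by omega
      lift k to ℕ using hk0
      have hzk : z = 2 * k - (2 * m : ℕ) := by omega
      rw [hzk, lineKernel_eq_choose, pow_mul]
      norm_num
      gcongr
      exact Nat.choose_le_centralBinom k m
  · rw [lineKernel_eq_zero_of_odd _ _ ho]; exact hpos

lemma centralBinom_ratio_succ (m : ℕ) :
    ((m + 1).centralBinom / 4 ^ (m + 1) : ℝ) * (2 * (m + 1)) =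
      (m.centralBinom / 4 ^ m) * (2 * m + 1) := by
  have h : ((m + 1 : ℕ) : ℝ) * (m + 1).centralBinom = 2 * (2 * m + 1) * m.centralBinom := by
    exact_mod_cast Nat.succ_mul_centralBinom_succ m
  push_cast at h
  rw [pow_succ]
  field_simp
  linarith

lemma sq_centralBinom_ratio_le (m : ℕ) :
    (m.centralBinom / 4 ^ m : ℝ) ^ 2 * (2 * m + 1) ≤ 1 := by
  induction m with
  | zero => simp
  | succ m ih =>
    have h := centralBinom_ratio_succ m
    set r : ℝ := m.centralBinom / 4 ^ m
    set s : ℝ := (m + 1).centralBinom / 4 ^ (m + 1)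
    have hm : (0 : ℝ) ≤ m := Nat.cast_nonneg m
    have hs : s = r * (2 * m + 1) / (2 * (m + 1)) := by
      rw [eq_div_iff (by positivity)]; exact h
    rw [hs]
    push_cast
    rw [div_pow, div_mul_eq_mul_div, div_le_one (by positivity)]
    have : (r * (2 * m + 1)) ^ 2 * (2 * (m + 1) + 1) =
        (r ^ 2 * (2 * m + 1)) * ((2 * m + 1) * (2 * (m + 1) + 1)) := by ring
    rw [this]
    have h0 : (0 : ℝ) ≤ (2 * m + 1) * (2 * (m + 1) + 1) := by positivity
    nlinarith [mul_le_mul_of_nonneg_right ih h0]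

lemma le_sq_centralBinom_ratio (m : ℕ) :
    1 ≤ ((m + 1).centralBinom / 4 ^ (m + 1) : ℝ) ^ 2 * (4 * (m + 1)) := by
  induction m with
  | zero => simp [Nat.centralBinom, Nat.choose]; norm_num
  | succ m ih =>
    have h := centralBinom_ratio_succ (m + 1)
    set r : ℝ := (m + 1).centralBinom / 4 ^ (m + 1)
    set s : ℝ := (m + 1 + 1).centralBinom / 4 ^ (m + 1 + 1)
    have hm : (0 : ℝ) ≤ m := Nat.cast_nonneg m
    push_cast at h ⊢
    have hs : s = r * (2 * (m + 1) + 1) / (2 * (m + 1 + 1)) := by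
      rw [eq_div_iff (by positivity)]; exact h
    rw [hs, div_pow, div_mul_eq_mul_div, le_div_iff₀ (by positivity)]
    have h0 : (0 : ℝ) ≤ (2 * (m + 1) + 1) ^ 2 * (m + 1 + 1) := by positivity
    have h1 := mul_le_mul_of_nonneg_right ih h0
    have hmul : (m + 1 : ℝ) * ((2 * (m + 1 + 1)) ^ 2) ≤ (2 * (m + 1) + 1) ^ 2 * (m + 1 + 1) := by
      nlinarith
    have hm1 : (0 : ℝ) < m + 1 := by positivity
    nlinarith

/-- The heat kernel of the simple random walk on `ℤ²`, a product of two line kernels after a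
rotation by a quarter turn. -/
noncomputable def planeKernel (m : ℕ) (u v : ℤ) : ℝ := lineKernel m (u + v) * lineKernel m (u - v)

lemma planeKernel_nonneg (m : ℕ) (u v : ℤ) : 0 ≤ planeKernel m u v :=
  mul_nonneg (lineKernel_nonneg _ _) (lineKernel_nonneg _ _)

lemma planeKernel_zero_zero : planeKernel 0 0 0 = 1 := by simp [planeKernel, lineKernel]

lemma planeKernel_succ (m : ℕ) (u v : ℤ) :
    planeKernel (m + 1) u v = (planeKernel m (u + 1) v + planeKernel m (u - 1) v +
      planeKernel m u (v + 1) + planeKernel m u (v - 1)) / 4 := by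
  simp only [planeKernel, lineKernel]
  rw [show u + 1 + v = u + v + 1 by ring, show u + 1 - v = u - v + 1 by ring,
    show u - 1 + v = u + v - 1 by ring, show u - 1 - v = u - v - 1 by ring,
    show u + (v + 1) = u + v + 1 by ring, show u - (v + 1) = u - v - 1 by ring,
    show u + (v - 1) = u + v - 1 by ring, show u - (v - 1) = u - v + 1 by ring]
  ring

lemma exists_lineKernel_le (j : ℕ) (hj : 1 ≤ j) :
    ∃ r : ℝ, 0 ≤ r ∧ r ^ 2 ≤ 1 / j ∧ ∀ z, lineKernel j z ≤ r := by
  obtain ⟨m, rfl | rfl⟩ : ∃ m, j = 2 * m ∨ j = 2 * m + 1 := ⟨j / 2, by omega⟩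
  all_goals
    have h := sq_centralBinom_ratio_le m
    have hm : (0 : ℝ) ≤ m := Nat.cast_nonneg m
    refine ⟨m.centralBinom / 4 ^ m, by positivity, ?_, ?_⟩
  · rw [le_div_iff₀ (by exact_mod_cast hj)]
    push_cast
    nlinarith [sq_nonneg (m.centralBinom / 4 ^ m : ℝ)]
  · exact lineKernel_two_mul_le m
  · rw [le_div_iff₀ (by exact_mod_cast hj)]
    push_cast
    exact h
  · intro z
    simp only [lineKernel]
    linarith [lineKernel_two_mul_le m (z + 1), lineKernel_two_mul_le m (z - 1)]

lemma planeKernel_le (j : ℕ) (hj : 1 ≤ j) (u v : ℤ) : planeKernel j u v ≤ 1 / j := by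
  obtain ⟨r, hr0, hr, hle⟩ := exists_lineKernel_le j hj
  refine le_trans ?_ hr
  rw [sq]
  exact mul_le_mul (hle _) (hle _) (lineKernel_nonneg _ _) hr0

lemma le_planeKernel_two_mul (m : ℕ) : 1 / (4 * (m + 1) : ℝ) ≤ planeKernel (2 * (m + 1)) 0 0 := by
  simp only [planeKernel, add_zero, sub_zero, lineKernel_two_mul_zero]
  rw [div_le_iff₀ (by positivity), ← sq]
  exact le_sq_centralBinom_ratio m

lemma sum_one_div_le (a b : ℕ) (ha : 1 ≤ a) (hab : a ≤ b) :
    ∑ j ∈ Finset.Icc a b, (1 / j : ℝ) ≤ 1 + Real.log (b / a) := by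
  induction b, hab using Nat.le_induction with
  | base =>
    have : (1 : ℝ) ≤ a := by exact_mod_cast ha
    simp only [Finset.Icc_self, Finset.sum_singleton]
    rw [div_self (by positivity), Real.log_one, add_zero]
    exact (div_le_one (by positivity)).2 this
  | succ b hb ih =>
    rw [Finset.sum_Icc_succ_top (by omega)]
    have ha' : (0 : ℝ) < a := by exact_mod_cast ha
    have hb' : (0 : ℝ) < b := by exact_mod_cast (by omega : 0 < b)
    have h := Real.one_sub_inv_le_log_of_pos (show (0 : ℝ) < ((b + 1 : ℕ) : ℝ) / b by positivity)
    rw [Real.log_div (by positivity) (by positivity)] at h ih ⊢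
    have h2 : 1 - (((b + 1 : ℕ) : ℝ) / b)⁻¹ = 1 / ((b + 1 : ℕ) : ℝ) := by
      push_cast; field_simp; ring
    linarith

lemma sum_planeKernel_Icc_le (a b : ℕ) (ha : 1 ≤ a) (hab : a ≤ b) (u v : ℤ) :
    ∑ j ∈ Finset.Icc a b, planeKernel j u v ≤ 1 + Real.log (b / a) :=
  (Finset.sum_le_sum fun j hj => planeKernel_le j (by simp at hj; omega) u v).trans
    (sum_one_div_le a b ha hab)

/-- The Green function of the planar simple random walk killed at time `r`. -/
noncomputable def green (r : ℕ) (u v : ℤ) : ℝ := ∑ m ∈ Finset.range r, planeKernel m u v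

lemma green_nonneg (r : ℕ) (u v : ℤ) : 0 ≤ green r u v :=
  Finset.sum_nonneg fun _ _ => planeKernel_nonneg _ _ _

lemma green_mono {r s : ℕ} (h : r ≤ s) (u v : ℤ) : green r u v ≤ green s u v :=
  Finset.sum_le_sum_of_subset_of_nonneg (Finset.range_mono h)
    fun _ _ _ => planeKernel_nonneg _ _ _

lemma green_succ (r : ℕ) (u v : ℤ) :
    green (r + 1) u v = planeKernel 0 u v + (green r (u + 1) v + green r (u - 1) v +
      green r u (v + 1) + green r u (v - 1)) / 4 := by
  unfold green
  rw [Finset.sum_range_succ', add_comm, ← Finset.sum_add_distrib, ← Finset.sum_add_distrib,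
    ← Finset.sum_add_distrib, Finset.sum_div]
  simp_rw [planeKernel_succ]

lemma green_zero_zero_le (n : ℕ) (hn : 1 ≤ n) : green (n + 1) 0 0 ≤ 2 + Real.log n := by
  unfold green
  rw [Finset.range_eq_Ico, Finset.sum_eq_sum_Ico_succ_bot (by omega)]
  have h := sum_planeKernel_Icc_le 1 n le_rfl hn 0 0
  have h2 : Finset.Ico (0 + 1) (n + 1) = Finset.Icc 1 n := by ext; simp
  rw [h2, planeKernel_zero_zero]
  simp at h
  linarith

lemma log_le_green (n : ℕ) : Real.log (n + 1) / 4 ≤ green (2 * n + 1) 0 0 := by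
  have h : (harmonic n : ℝ) / 4 ≤ green (2 * n + 1) 0 0 := by
    induction n with
    | zero => simpa using green_nonneg _ _ _
    | succ n ih =>
      rw [harmonic_succ]
      have h1 := le_planeKernel_two_mul n
      have h2 := planeKernel_nonneg (2 * n + 1) 0 0
      unfold green at ih ⊢
      rw [show 2 * (n + 1) + 1 = 2 * n + 1 + 1 + 1 by ring, Finset.sum_range_succ,
        Finset.sum_range_succ]
      rw [show 2 * n + 1 + 1 = 2 * (n + 1) by ring]
      push_cast
      have h3 : 1 / (4 * (n + 1) : ℝ) = (n + 1 : ℝ)⁻¹ / 4 := by field_simp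
      linarith
  have := log_add_one_le_harmonic n
  push_cast at this
  linarith

/-- The trajectory `s 0, …, s n`, most recent position first. -/
def history (s : ℕ → Fin 4 → ℤ) : ℕ → List (Fin 4 → ℤ)
  | 0 => [s 0]
  | n + 1 => s (n + 1) :: history s n

lemma history_eq_cons (s : ℕ → Fin 4 → ℤ) (n : ℕ) : ∃ t, history s n = s n :: t := by
  cases n <;> exact ⟨_, rfl⟩

lemma length_history (s : ℕ → Fin 4 → ℤ) (n : ℕ) : (history s n).length = n + 1 := by
  induction n with
  | zero => rfl
  | succ n ih => simp [history, ih]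

lemma history_eq_iff (s s' : ℕ → Fin 4 → ℤ) (n : ℕ) :
    history s n = history s' n ↔ ∀ k ≤ n, s k = s' k := by
  induction n with
  | zero => simp [history]
  | succ n ih =>
    simp only [history, List.cons.injEq, ih]
    constructor
    · rintro ⟨h1, h2⟩ k hk
      rcases Nat.le_succ_iff.1 hk with h | rfl
      exacts [h2 k h, h1]
    · intro h
      exact ⟨h _ le_rfl, fun k hk => h k (by omega)⟩

lemma mem_history (s : ℕ → Fin 4 → ℤ) (n : ℕ) (x : Fin 4 → ℤ) :
    x ∈ history s n ↔ ∃ k ≤ n, s k = x := by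
  induction n with
  | zero => simp [history, eq_comm]
  | succ n ih =>
    simp only [history, List.mem_cons, ih]
    constructor
    · rintro (rfl | ⟨k, hk, rfl⟩)
      exacts [⟨_, le_rfl, rfl⟩, ⟨k, by omega, rfl⟩]
    · rintro ⟨k, hk, rfl⟩
      rcases Nat.le_succ_iff.1 hk with h | rfl
      exacts [Or.inr ⟨k, h, rfl⟩, Or.inl rfl]

lemma history_suffix (s : ℕ → Fin 4 → ℤ) {j n : ℕ} (h : j ≤ n) :
    history s j <:+ history s n := by
  induction n, h using Nat.le_induction with
  | base => exact List.suffix_rfl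
  | succ n _ ih => exact ih.trans (List.suffix_cons _ _)

/-- The two coordinates spanning one of the two orthogonal coordinate planes of `ℤ⁴`. -/
def axis₁ (b : Bool) : Fin 4 := if b then 0 else 2

/-- See `axis₁`. -/
def axis₂ (b : Bool) : Fin 4 := if b then 1 else 3

/-- The average of `f` over the four nearest-neighbour moves in the plane `b`. -/
noncomputable def planeAvg (b : Bool) (f : List (Fin 4 → ℤ) → ℝ) (x : Fin 4 → ℤ)
    (t : List (Fin 4 → ℤ)) : ℝ :=
  (f ((x + (1 : ℤ) • unitVec 4 (axis₁ b)) :: x :: t) +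
    f ((x + (-1 : ℤ) • unitVec 4 (axis₁ b)) :: x :: t) +
    f ((x + (1 : ℤ) • unitVec 4 (axis₂ b)) :: x :: t) +
    f ((x + (-1 : ℤ) • unitVec 4 (axis₂ b)) :: x :: t)) / 4

/-- A rule prescribes the probability of moving in each plane, given the trajectory. -/
structure IsRule (w : Bool → List (Fin 4 → ℤ) → ℝ) : Prop where
  nonneg : ∀ b L, 0 ≤ w b L
  add_not : ∀ b L, w b L + w (!b) L = 1

/-- One step of the walk following the rule `w`. -/
noncomputable def stepAvg (w : Bool → List (Fin 4 → ℤ) → ℝ) (f : List (Fin 4 → ℤ) → ℝ)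
    (x : Fin 4 → ℤ) (t : List (Fin 4 → ℤ)) : ℝ :=
  w true (x :: t) * planeAvg true f x t + w false (x :: t) * planeAvg false f x t

lemma stepAvg_eq (w : Bool → List (Fin 4 → ℤ) → ℝ) (b : Bool) (f : List (Fin 4 → ℤ) → ℝ)
    (x : Fin 4 → ℤ) (t : List (Fin 4 → ℤ)) :
    stepAvg w f x t =
      w b (x :: t) * planeAvg b f x t + w (!b) (x :: t) * planeAvg (!b) f x t := by
  cases b <;> simp [stepAvg, add_comm]

lemma planeAvg_le_of_forall {b : Bool} {f : List (Fin 4 → ℤ) → ℝ} {x : Fin 4 → ℤ}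
    {t : List (Fin 4 → ℤ)} {c : ℝ}
    (h : ∀ y : Fin 4 → ℤ, y (axis₁ !b) = x (axis₁ !b) → y (axis₂ !b) = x (axis₂ !b) →
      (y (axis₁ b) ≠ x (axis₁ b) ∨ y (axis₂ b) ≠ x (axis₂ b)) → f (y :: x :: t) ≤ c) :
    planeAvg b f x t ≤ c := by
  have key : ∀ ε : ℤ, ε ≠ 0 → ∀ i, (i = axis₁ b ∨ i = axis₂ b) →
      f ((x + ε • unitVec 4 i) :: x :: t) ≤ c := by
    intro ε hε i hi
    rcases hi with rfl | rfl <;> refine h _ ?_ ?_ ?_ <;> cases b <;>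
      simp [unitVec, axis₁, axis₂, hε]
  have h1 := key 1 (by norm_num) _ (Or.inl rfl)
  have h2 := key (-1) (by norm_num) _ (Or.inl rfl)
  have h3 := key 1 (by norm_num) _ (Or.inr rfl)
  have h4 := key (-1) (by norm_num) _ (Or.inr rfl)
  unfold planeAvg
  linarith

lemma stepAvg_le_of_planeAvg_le {w : Bool → List (Fin 4 → ℤ) → ℝ} (hw : IsRule w)
    {f : List (Fin 4 → ℤ) → ℝ} {x : Fin 4 → ℤ} {t : List (Fin 4 → ℤ)} {c : ℝ}
    (h : ∀ b, planeAvg b f x t ≤ c) : stepAvg w f x t ≤ c := by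
  have h1 := mul_le_mul_of_nonneg_left (h true) (hw.nonneg true (x :: t))
  have h2 := mul_le_mul_of_nonneg_left (h false) (hw.nonneg false (x :: t))
  have h3 := hw.add_not true (x :: t)
  simp only [Bool.not_true] at h3
  calc stepAvg w f x t ≤ w true (x :: t) * c + w false (x :: t) * c := add_le_add h1 h2
    _ = c := by rw [← add_mul, h3, one_mul]

/-- The number of moves in the plane `b` along a trajectory. -/
def planeMoves (b : Bool) : List (Fin 4 → ℤ) → ℕ
  | [] => 0
  | [_] => 0
  | y :: x :: t =>
    planeMoves b (x :: t) + if y (axis₁ b) = x (axis₁ b) ∧ y (axis₂ b) = x (axis₂ b) then 0 else 1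

lemma planeMoves_cons_of_ne {b : Bool} {x y : Fin 4 → ℤ} (t : List (Fin 4 → ℤ))
    (h : y (axis₁ b) ≠ x (axis₁ b) ∨ y (axis₂ b) ≠ x (axis₂ b)) :
    planeMoves b (y :: x :: t) = planeMoves b (x :: t) + 1 := by
  rw [planeMoves, if_neg (by tauto)]

lemma planeMoves_cons_of_eq {b : Bool} {x y : Fin 4 → ℤ} (t : List (Fin 4 → ℤ))
    (h₁ : y (axis₁ b) = x (axis₁ b)) (h₂ : y (axis₂ b) = x (axis₂ b)) :
    planeMoves b (y :: x :: t) = planeMoves b (x :: t) := by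
  rw [planeMoves, if_pos ⟨h₁, h₂⟩, add_zero]

lemma planeMoves_le_succ (b : Bool) (y : Fin 4 → ℤ) (t : List (Fin 4 → ℤ)) :
    planeMoves b (y :: t) ≤ planeMoves b t + 1 := by
  cases t with
  | nil => simp [planeMoves]
  | cons x t => rw [planeMoves]; split_ifs <;> omega

lemma planeMoves_le_cons (b : Bool) (y : Fin 4 → ℤ) (t : List (Fin 4 → ℤ)) :
    planeMoves b t ≤ planeMoves b (y :: t) := by
  cases t with
  | nil => simp [planeMoves]
  | cons x t => rw [planeMoves]; omega

lemma planeMoves_history_le (b : Bool) (s : ℕ → Fin 4 → ℤ) (n : ℕ) :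
    planeMoves b (history s n) ≤ n := by
  induction n with
  | zero => simp [history, planeMoves]
  | succ n ih => exact (planeMoves_le_succ _ _ _).trans (by omega)

lemma planeMoves_history_mono (b : Bool) (s : ℕ → Fin 4 → ℤ) {m n : ℕ} (h : m ≤ n) :
    planeMoves b (history s m) ≤ planeMoves b (history s n) := by
  induction n, h using Nat.le_induction with
  | base => exact le_rfl
  | succ n _ ih => exact ih.trans (planeMoves_le_cons _ _ _)

/-- `S` follows the rule `w`: the expectation of nonnegative functions of the trajectory evolves
according to `stepAvg w`. -/
def Follows {Ω : Type*} [MeasurableSpace Ω] (P : Measure Ω) (S : ℕ → Ω → Fin 4 → ℤ)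
    (w : Bool → List (Fin 4 → ℤ) → ℝ) : Prop :=
  (∀ n, Measurable (S n)) ∧ (∀ᵐ ω ∂P, S 0 ω = 0) ∧
  ∀ (n : ℕ) (f g : List (Fin 4 → ℤ) → ℝ), (∀ L, 0 ≤ f L) →
    (∀ x t, (x :: t).length = n + 1 → stepAvg w f x t ≤ g (x :: t)) →
    ∫⁻ ω, ENNReal.ofReal (f (history (S · ω) (n + 1))) ∂P ≤
      ∫⁻ ω, ENNReal.ofReal (g (history (S · ω) n)) ∂P

lemma Follows.lintegral_le {Ω : Type*} [MeasurableSpace Ω] {P : Measure Ω}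
    [IsProbabilityMeasure P] {S : ℕ → Ω → Fin 4 → ℤ} {w : Bool → List (Fin 4 → ℤ) → ℝ}
    (hS : Follows P S w) (n : ℕ) (f : List (Fin 4 → ℤ) → ℝ) (hf : ∀ L, 0 ≤ f L)
    (h : ∀ x t, (x :: t).length ≤ n → stepAvg w f x t ≤ f (x :: t)) :
    ∫⁻ ω, ENNReal.ofReal (f (history (S · ω) n)) ∂P ≤ ENNReal.ofReal (f [0]) := by
  induction n with
  | zero =>
    have h0 : ∀ᵐ ω ∂P, ENNReal.ofReal (f (history (S · ω) 0)) = ENNReal.ofReal (f [0]) := by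
      filter_upwards [hS.2.1] with ω hω
      simp [history, hω]
    rw [lintegral_congr_ae h0]
    simp
  | succ n ih =>
    exact (hS.2.2 n f f hf fun x t hx => h x t hx.le).trans
      (ih fun x t hx => h x t (by omega))

lemma measurable_comp_history {Ω β : Type*} [MeasurableSpace Ω] [MeasurableSpace β]
    {S : ℕ → Ω → Fin 4 → ℤ} (hS : ∀ n, Measurable (S n)) (n : ℕ)
    (f : List (Fin 4 → ℤ) → β) : Measurable fun ω => f (history (S · ω) n) := by
  let _ : MeasurableSpace (List (Fin 4 → ℤ)) := ⊤
  have h : Measurable fun ω => history (S · ω) n := by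
    refine measurable_to_countable' fun L => ?_
    rcases Set.eq_empty_or_nonempty ((fun ω => history (S · ω) n) ⁻¹' {L}) with h | ⟨ω₀, h⟩
    · rw [h]; exact MeasurableSet.empty
    · obtain rfl : history (S · ω₀) n = L := h
      have : (fun ω => history (S · ω) n) ⁻¹' {history (S · ω₀) n} =
          ⋂ k ∈ Finset.range (n + 1), S k ⁻¹' {S k ω₀} := by
        ext ω
        simp [history_eq_iff]
      rw [this]
      exact Finset.measurableSet_biInter _ fun k _ => hS k (measurableSet_singleton _)
  exact measurable_from_top.comp h

/-- The potential `f` controls the probability of a set of trajectories. -/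
lemma Follows.measureReal_le {Ω : Type*} [MeasurableSpace Ω] {P : Measure Ω}
    [IsProbabilityMeasure P] {S : ℕ → Ω → Fin 4 → ℤ} {w : Bool → List (Fin 4 → ℤ) → ℝ}
    (hS : Follows P S w) (n : ℕ) (f : List (Fin 4 → ℤ) → ℝ) (hf : ∀ L, 0 ≤ f L)
    (h : ∀ x t, (x :: t).length ≤ n → stepAvg w f x t ≤ f (x :: t)) {c : ℝ} (hc : 0 < c)
    (A : Set Ω) (hA : ∀ ω ∈ A, c ≤ f (history (S · ω) n)) :
    P.real A ≤ f [0] / c := by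
  have h1 : ENNReal.ofReal c * P A ≤ ENNReal.ofReal (f [0]) := by
    refine le_trans ?_ (hS.lintegral_le n f hf h)
    refine le_trans ?_ (mul_meas_ge_le_lintegral₀
      (measurable_comp_history hS.1 n fun L => ENNReal.ofReal (f L)).aemeasurable (ENNReal.ofReal c))
    gcongr
    exact fun ω hω => ENNReal.ofReal_le_ofReal (hA ω hω)
  rw [Measure.real, le_div_iff₀ hc, mul_comm]
  have h2 := ENNReal.toReal_mono ENNReal.ofReal_ne_top h1
  rwa [ENNReal.toReal_mul, ENNReal.toReal_ofReal hc.le, ENNReal.toReal_ofReal (hf _)] at h2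

lemma lintegral_uniform_step {Ω : Type*} [MeasurableSpace Ω] {P : Measure Ω}
    [IsProbabilityMeasure P] {m : ℕ} (hm : 0 < m) {e : Fin m → Fin 4}
    (he : Function.Injective e) {E : Set Ω} (hE : MeasurableSet E) {Z : Ω → Fin 4 → ℤ}
    (hZ : Measurable Z) (x : Fin 4 → ℤ)
    (h : ∀ i, ∀ ε : ℤ, ε = 1 ∨ ε = -1 →
      P (E ∩ {ω | Z ω = x + ε • unitVec 4 (e i)}) = P E / (2 * m))
    (f : (Fin 4 → ℤ) → ℝ) (hf : ∀ y, 0 ≤ f y) :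
    ∫⁻ ω in E, ENNReal.ofReal (f (Z ω)) ∂P =
      ENNReal.ofReal ((∑ i, (f (x + (1 : ℤ) • unitVec 4 (e i)) +
        f (x + (-1 : ℤ) • unitVec 4 (e i)))) / (2 * m)) * P E := by
  set y : Fin m × Bool → Fin 4 → ℤ := fun a => x + (if a.2 then 1 else -1 : ℤ) • unitVec 4 (e a.1)
    with hy
  have hyinj : Function.Injective y := by
    rintro ⟨i, a⟩ ⟨j, b⟩ hab
    have h1 : (if a then 1 else -1 : ℤ) • unitVec 4 (e i) =
      (if b then 1 else -1 : ℤ) • unitVec 4 (e j) := add_left_cancel hab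
    have hij : e i = e j := by
      by_contra hne
      have := congrFun h1 (e i)
      simp [unitVec, hne] at this
      split_ifs at this <;> simp at this
    have h2 := congrFun h1 (e i)
    rw [hij] at h2
    refine Prod.ext (he hij) ?_
    cases a <;> cases b <;> simp [unitVec] at h2 ⊢
  set B : Fin m × Bool → Set Ω := fun a => E ∩ {ω | Z ω = y a} with hB
  have hBm : ∀ a, MeasurableSet (B a) := fun a => hE.inter (hZ (measurableSet_singleton _))
  have hBd : Pairwise (Function.onFun Disjoint B) := by
    intro a b hab
    refine Set.disjoint_left.2 fun ω h1 h2 => hab (hyinj ?_)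
    exact h1.2.symm.trans h2.2
  have hBP : ∀ a, P (B a) = P E / (2 * m) := by
    rintro ⟨i, b⟩
    cases b
    · exact h i (-1) (Or.inr rfl)
    · exact h i 1 (Or.inl rfl)
  have hm' : (m : ENNReal) ≠ 0 := by exact_mod_cast hm.ne'
  have hsub : (⋃ a, B a) ⊆ E := Set.iUnion_subset fun a => Set.inter_subset_left
  have hPU : P (⋃ a, B a) = P E := by
    rw [measure_iUnion hBd hBm, tsum_fintype]
    simp only [hBP, Finset.sum_const, Finset.card_univ, Fintype.card_prod, Fintype.card_fin,
      Fintype.card_bool, nsmul_eq_mul, Nat.cast_mul, Nat.cast_ofNat]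
    rw [mul_comm (m : ENNReal) 2]
    refine ENNReal.mul_div_cancel (by simp [hm']) (by finiteness)
  have hae : (⋃ a, B a) =ᵐ[P] E :=
    ae_eq_of_subset_of_measure_ge hsub hPU.ge (MeasurableSet.iUnion hBm).nullMeasurableSet
      (measure_ne_top _ _)
  rw [← setLIntegral_congr hae, lintegral_iUnion hBm hBd, tsum_fintype]
  have hset : ∀ a, ∫⁻ ω in B a, ENNReal.ofReal (f (Z ω)) ∂P =
      ENNReal.ofReal (f (y a) / (2 * m)) * P E := by
    intro a
    have h1 : ∫⁻ ω in B a, ENNReal.ofReal (f (Z ω)) ∂P =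
        ∫⁻ _ in B a, ENNReal.ofReal (f (y a)) ∂P :=
      setLIntegral_congr_fun (hBm a) fun ω hω => by
        have : Z ω = y a := hω.2
        simp only [this]
    rw [h1, setLIntegral_const, hBP, ENNReal.ofReal_div_of_pos (by positivity),
      ENNReal.ofReal_mul (by norm_num), ENNReal.ofReal_natCast, ENNReal.ofReal_ofNat,
      ENNReal.mul_comm_div]
  simp only [hset]
  rw [← Finset.sum_mul, ← ENNReal.ofReal_sum_of_nonneg fun a _ => by
    have := hf (y a); positivity]
  congr 2
  rw [Fintype.sum_prod_type, Finset.sum_div]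
  refine Finset.sum_congr rfl fun i _ => ?_
  simp [hy, add_div]

/-- The rule moving in the plane `true` with probability `p` at old sites, and with probability
`q` at new ones. -/
noncomputable def visitRule (p q : ℝ) (b : Bool) (L : List (Fin 4 → ℤ)) : ℝ :=
  if L.headD 0 ∈ L.tail then (if b then p else 1 - p) else (if b then q else 1 - q)

lemma visitRule_cons_of_mem {p q : ℝ} {b : Bool} {x : Fin 4 → ℤ} {t : List (Fin 4 → ℤ)}
    (h : x ∈ t) : visitRule p q b (x :: t) = if b then p else 1 - p := by
  simp [visitRule, h]

lemma visitRule_cons_of_notMem {p q : ℝ} {b : Bool} {x : Fin 4 → ℤ} {t : List (Fin 4 → ℤ)}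
    (h : x ∉ t) : visitRule p q b (x :: t) = if b then q else 1 - q := by
  simp [visitRule, h]

lemma isRule_visitRule {p q : ℝ} (hp : p ∈ Set.Icc 0 1) (hq : q ∈ Set.Icc 0 1) :
    IsRule (visitRule p q) where
  nonneg b L := by
    unfold visitRule
    obtain ⟨h1, h2⟩ := hp
    obtain ⟨h3, h4⟩ := hq
    split_ifs <;> linarith
  add_not b L := by
    unfold visitRule
    split_ifs <;> cases b <;> simp_all

/-- It is enough to check the evolution on each cylinder event. -/
lemma follows_of_cylinder {Ω : Type*} [MeasurableSpace Ω] {P : Measure Ω}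
    {S : ℕ → Ω → Fin 4 → ℤ} {w : Bool → List (Fin 4 → ℤ) → ℝ}
    (hS : ∀ n, Measurable (S n)) (hS0 : ∀ᵐ ω ∂P, S 0 ω = 0)
    (h : ∀ (n : ℕ) (s : ℕ → Fin 4 → ℤ) (t : List (Fin 4 → ℤ)), history s n = s n :: t →
      (s n ∈ t ↔ ∃ k < n, s n = s k) → ∀ f : List (Fin 4 → ℤ) → ℝ, (∀ L, 0 ≤ f L) →
      ∫⁻ ω in {ω | ∀ k ≤ n, S k ω = s k}, ENNReal.ofReal (f (S (n + 1) ω :: s n :: t)) ∂P =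
        ENNReal.ofReal (stepAvg w f (s n) t) * P {ω | ∀ k ≤ n, S k ω = s k}) :
    Follows P S w := by
  refine ⟨hS, hS0, fun n f g hf hfg => ?_⟩
  set H : Ω → List (Fin 4 → ℤ) := fun ω => history (S · ω) n with hH
  have hm : ∀ L, MeasurableSet (H ⁻¹' {L}) := by
    intro L
    let _ : MeasurableSpace (List (Fin 4 → ℤ)) := ⊤
    exact measurable_comp_history hS n id trivial
  have hd : Pairwise (Function.onFun Disjoint fun L => H ⁻¹' {L}) := by
    intro L L' hne
    exact Disjoint.preimage _ (by simpa using hne)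
  have hU : (⋃ L, H ⁻¹' {L}) = Set.univ := by
    ext ω; simp
  rw [← setLIntegral_univ, ← setLIntegral_univ (fun ω => ENNReal.ofReal (g _)), ← hU,
    lintegral_iUnion hm hd, lintegral_iUnion hm hd]
  refine ENNReal.tsum_le_tsum fun L => ?_
  rcases Set.eq_empty_or_nonempty (H ⁻¹' {L}) with hL | ⟨ω₀, hL⟩
  · simp [hL]
  obtain rfl : H ω₀ = L := hL
  set s : ℕ → Fin 4 → ℤ := (S · ω₀) with hs
  have hE : H ⁻¹' {H ω₀} = {ω | ∀ k ≤ n, S k ω = s k} := by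
    ext ω
    simp only [Set.mem_preimage, Set.mem_singleton_iff, Set.mem_ofPred_eq, hH]
    exact history_eq_iff _ _ _
  obtain ⟨t, ht⟩ : ∃ t, history s n = s n :: t := history_eq_cons s n
  have hmem : s n ∈ t ↔ ∃ k < n, s n = s k := by
    cases n with
    | zero =>
      simp only [history, List.cons.injEq, true_and] at ht
      simp [← ht]
    | succ n =>
      simp only [history, List.cons.injEq, true_and] at ht
      rw [← ht, mem_history]
      simp [eq_comm]
  have h1 : ∫⁻ ω in H ⁻¹' {H ω₀}, ENNReal.ofReal (f (history (S · ω) (n + 1))) ∂P =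
      ∫⁻ ω in H ⁻¹' {H ω₀}, ENNReal.ofReal (f (S (n + 1) ω :: s n :: t)) ∂P := by
    refine setLIntegral_congr_fun (hm _) fun ω hω => ?_
    have : history (S · ω) n = s n :: t := Eq.trans hω ht
    simp only [history, this]
  have h2 : ∫⁻ ω in H ⁻¹' {H ω₀}, ENNReal.ofReal (g (history (S · ω) n)) ∂P =
      ∫⁻ _ in H ⁻¹' {H ω₀}, ENNReal.ofReal (g (s n :: t)) ∂P := by
    refine setLIntegral_congr_fun (hm _) fun ω hω => ?_
    have : history (S · ω) n = s n :: t := Eq.trans hω ht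
    simp only [this]
  rw [h1, h2, setLIntegral_const, hE, h n s t ht hmem f hf]
  gcongr
  exact hfg _ _ (by rw [← ht, length_history])

lemma follows_of_isBERW_four_two {Ω : Type*} [MeasurableSpace Ω] {P : Measure Ω}
    [IsProbabilityMeasure P] {S : ℕ → Ω → Fin 4 → ℤ} (hS : IsBERW 4 4 2 P S) :
    Follows P S (visitRule 0 (1 / 2)) := by
  obtain ⟨hm, h0, hnew, hold⟩ := hS
  refine follows_of_cylinder hm h0 fun n s t ht hmem f hf => ?_
  have hE : MeasurableSet {ω | ∀ k ≤ n, S k ω = s k} := by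
    simp only [Set.ofPred_forall]
    exact .iInter fun k => .iInter fun _ => hm k (measurableSet_singleton _)
  by_cases hv : s n ∈ t
  · rw [lintegral_uniform_step (m := 2) two_pos (e := Fin.natAdd 2)
      (Fin.natAdd_injective 2 2) hE (hm (n + 1)) (s n)
      (fun i ε hε => hold n s (hmem.1 hv) _ (by simp) ε hε) (fun y => f (y :: s n :: t))
      fun y => hf _]
    congr 2
    simp only [stepAvg, planeAvg, visitRule_cons_of_mem hv, Fin.sum_univ_two]
    simp [axis₁, axis₂, Fin.natAdd]
    ring_nf
  · rw [lintegral_uniform_step (m := 4) four_pos (e := id)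
      Function.injective_id hE (hm (n + 1)) (s n)
      (fun i ε hε => hnew n s (by simpa using fun h => hv (hmem.2 h)) _ (by simp) ε hε)
      (fun y => f (y :: s n :: t)) fun y => hf _]
    congr 2
    simp only [stepAvg, planeAvg, visitRule_cons_of_notMem hv, Fin.sum_univ_four]
    simp [axis₁, axis₂]
    ring

lemma follows_of_isBERW_two_four {Ω : Type*} [MeasurableSpace Ω] {P : Measure Ω}
    [IsProbabilityMeasure P] {S : ℕ → Ω → Fin 4 → ℤ} (hS : IsBERW 4 2 4 P S) :
    Follows P S (visitRule (1 / 2) 1) := by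
  obtain ⟨hm, h0, hnew, hold⟩ := hS
  refine follows_of_cylinder hm h0 fun n s t ht hmem f hf => ?_
  have hE : MeasurableSet {ω | ∀ k ≤ n, S k ω = s k} := by
    simp only [Set.ofPred_forall]
    exact .iInter fun k => .iInter fun _ => hm k (measurableSet_singleton _)
  by_cases hv : s n ∈ t
  · rw [lintegral_uniform_step (m := 4) four_pos (e := id)
      Function.injective_id hE (hm (n + 1)) (s n)
      (fun i ε hε => hold n s (hmem.1 hv) _ (by simp) ε hε)
      (fun y => f (y :: s n :: t)) fun y => hf _]
    congr 2
    simp only [stepAvg, planeAvg, visitRule_cons_of_mem hv, Fin.sum_univ_four]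
    simp [axis₁, axis₂]
    ring
  · rw [lintegral_uniform_step (m := 2) two_pos (e := Fin.castAdd 2)
      (Fin.castAdd_injective 2 2) hE (hm (n + 1)) (s n)
      (fun i ε hε => hnew n s (by simpa using fun h => hv (hmem.2 h)) _ (by simp; omega) ε hε)
      (fun y => f (y :: s n :: t)) fun y => hf _]
    congr 2
    simp only [stepAvg, planeAvg, visitRule_cons_of_notMem hv, Fin.sum_univ_two]
    simp [axis₁, axis₂, Fin.castAdd, Fin.castLE]
    ring_nf

lemma stepAvg_mono {w : Bool → List (Fin 4 → ℤ) → ℝ} (hw : IsRule w)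
    {f g : List (Fin 4 → ℤ) → ℝ} {x : Fin 4 → ℤ} {t : List (Fin 4 → ℤ)}
    (h : ∀ y, f (y :: x :: t) ≤ g (y :: x :: t)) : stepAvg w f x t ≤ stepAvg w g x t := by
  have := hw.nonneg
  have key : ∀ b, planeAvg b f x t ≤ planeAvg b g x t := by
    intro b
    unfold planeAvg
    gcongr <;> exact h _
  exact add_le_add (mul_le_mul_of_nonneg_left (key _) (this _ _))
    (mul_le_mul_of_nonneg_left (key _) (this _ _))

/-- A supermartingale which is at least `1` on a set of trajectories controls the probability of
ever entering this set. -/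
lemma Follows.measureReal_exists_le {Ω : Type*} [MeasurableSpace Ω] {P : Measure Ω}
    [IsProbabilityMeasure P] {S : ℕ → Ω → Fin 4 → ℤ} {w : Bool → List (Fin 4 → ℤ) → ℝ}
    (hS : Follows P S w) (hw : IsRule w) (n : ℕ) (f : List (Fin 4 → ℤ) → ℝ) (hf : ∀ L, 0 ≤ f L)
    (h : ∀ x t, stepAvg w f x t ≤ f (x :: t)) (B : List (Fin 4 → ℤ) → Prop)
    (hB : ∀ L, B L → 1 ≤ f L) :
    P.real {ω | ∃ j ≤ n, B (history (S · ω) j)} ≤ f [0] := by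
  classical
  set F : List (Fin 4 → ℤ) → ℝ := fun L => if ∃ L', L' <:+ L ∧ L' ≠ [] ∧ B L' then 1 else f L
    with hF
  have hF0 : F [0] ≤ f [0] := by
    simp only [hF]
    split_ifs with h0
    · obtain ⟨L', h1, h2, h3⟩ := h0
      rcases List.suffix_cons_iff.1 h1 with rfl | h1
      · exact hB _ h3
      · exact absurd (List.suffix_nil.1 h1) h2
    · exact le_rfl
  refine le_trans ?_ hF0
  rw [← div_one (F [0])]
  refine hS.measureReal_le n F ?_ ?_ one_pos _ ?_
  · intro L
    simp only [hF]
    split_ifs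
    exacts [zero_le_one, hf L]
  · intro x t _
    by_cases hx : ∃ L', L' <:+ x :: t ∧ L' ≠ [] ∧ B L'
    · simp only [hF, if_pos hx]
      refine stepAvg_le_of_planeAvg_le hw fun b => planeAvg_le_of_forall fun y _ _ _ => ?_
      obtain ⟨L', h1, h2⟩ := hx
      rw [if_pos ⟨L', h1.trans (List.suffix_cons _ _), h2⟩]
    · have hFx : F (x :: t) = f (x :: t) := by simp only [hF, if_neg hx]
      rw [hFx]
      refine (stepAvg_mono hw fun y => ?_).trans (h x t)
      simp only [hF]
      split_ifs with hy
      · obtain ⟨L', h1, h2, h3⟩ := hy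
        rcases List.suffix_cons_iff.1 h1 with rfl | h1
        · exact hB _ h3
        · exact absurd ⟨L', h1, h2, h3⟩ hx
      · exact le_rfl
  · rintro ω ⟨j, hj, hBj⟩
    have : ∃ L', L' <:+ history (S · ω) n ∧ L' ≠ [] ∧ B L' := by
      refine ⟨_, history_suffix _ hj, ?_, hBj⟩
      obtain ⟨t, ht⟩ := history_eq_cons (S · ω) j
      simp [ht]
    simp only [hF, if_pos this, le_refl]

/-- The expected number of visits to the origin in the time window `[max a k, N]` of a planar
simple random walk which is at `(u, v)` at time `k`. -/
noncomputable def windowGreen (a N : ℕ) (u v : ℤ) (k : ℕ) : ℝ :=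
  ∑ j ∈ Finset.range (N + 1), if a ≤ j ∧ k ≤ j then planeKernel (j - k) u v else 0

lemma windowGreen_nonneg (a N : ℕ) (u v : ℤ) (k : ℕ) : 0 ≤ windowGreen a N u v k :=
  Finset.sum_nonneg fun _ _ => by split_ifs; exacts [planeKernel_nonneg _ _ _, le_rfl]

lemma windowGreen_superharmonic (a N : ℕ) (u v : ℤ) (k : ℕ) :
    (windowGreen a N (u + 1) v (k + 1) + windowGreen a N (u - 1) v (k + 1) +
      windowGreen a N u (v + 1) (k + 1) + windowGreen a N u (v - 1) (k + 1)) / 4 ≤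
      windowGreen a N u v k := by
  unfold windowGreen
  rw [← Finset.sum_add_distrib, ← Finset.sum_add_distrib, ← Finset.sum_add_distrib,
    Finset.sum_div]
  refine Finset.sum_le_sum fun j _ => ?_
  by_cases h1 : a ≤ j ∧ k + 1 ≤ j
  · have h2 : a ≤ j ∧ k ≤ j := ⟨h1.1, by omega⟩
    simp only [if_pos h1, if_pos h2]
    rw [show j - k = (j - (k + 1)) + 1 by omega, planeKernel_succ]
  · simp only [if_neg h1]
    have := planeKernel_nonneg (j - k) u v
    split_ifs <;> linarith

lemma green_le_windowGreen (a M k : ℕ) (ha : a ≤ k) (hk : k ≤ M) :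
    green (M + 1) 0 0 ≤ windowGreen a (2 * M) 0 0 k := by
  unfold windowGreen green
  rw [← Finset.sum_filter]
  have hinj : Set.InjOn (fun j : ℕ => j + k) (Finset.range (M + 1) : Set ℕ) :=
    fun i _ j _ h => Nat.add_right_cancel h
  calc ∑ m ∈ Finset.range (M + 1), planeKernel m 0 0
      = ∑ j ∈ (Finset.range (M + 1)).image (fun j => j + k), planeKernel (j - k) 0 0 := by
        rw [Finset.sum_image hinj]; simp
    _ ≤ _ := by
        refine Finset.sum_le_sum_of_subset_of_nonneg ?_ fun _ _ _ => planeKernel_nonneg _ _ _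
        intro j hj
        simp only [Finset.mem_image, Finset.mem_range, Finset.mem_filter] at hj ⊢
        omega

lemma windowGreen_zero_le (a N : ℕ) (ha : 1 ≤ a) (haN : a ≤ N) (u v : ℤ) :
    windowGreen a N u v 0 ≤ 1 + Real.log (N / a) := by
  refine le_trans (le_of_eq ?_) (sum_planeKernel_Icc_le a N ha haN u v)
  unfold windowGreen
  rw [← Finset.sum_filter]
  refine Finset.sum_congr ?_ fun _ _ => by simp
  ext j
  simp
  omega

/-- `windowGreen` evaluated along the projection of the walk to the plane `b`, recentred at the
target `z`. -/
noncomputable def windowPotential (a N : ℕ) (z : Fin 4 → ℤ) (b : Bool)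
    (L : List (Fin 4 → ℤ)) : ℝ :=
  windowGreen a N (L.headD 0 (axis₁ b) - z (axis₁ b)) (L.headD 0 (axis₂ b) - z (axis₂ b))
    (planeMoves b L)

lemma planeAvg_windowPotential_le (a N : ℕ) (z : Fin 4 → ℤ) (b : Bool) (x : Fin 4 → ℤ)
    (t : List (Fin 4 → ℤ)) :
    planeAvg b (fun L => windowPotential a N z b L * windowPotential a N z (!b) L) x t ≤
      windowPotential a N z b (x :: t) * windowPotential a N z (!b) (x :: t) := by
  have hother : ∀ ε : ℤ, ∀ i, (i = axis₁ b ∨ i = axis₂ b) →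
      windowPotential a N z (!b) ((x + ε • unitVec 4 i) :: x :: t) =
        windowPotential a N z (!b) (x :: t) := by
    intro ε i hi
    unfold windowPotential
    rw [planeMoves_cons_of_eq]
    all_goals rcases hi with rfl | rfl <;> cases b <;> simp [unitVec, axis₁, axis₂]
  have hmoves : ∀ ε : ℤ, ε ≠ 0 → ∀ i, (i = axis₁ b ∨ i = axis₂ b) →
      planeMoves b ((x + ε • unitVec 4 i) :: x :: t) = planeMoves b (x :: t) + 1 := by
    intro ε hε i hi
    refine planeMoves_cons_of_ne _ ?_
    rcases hi with rfl | rfl <;> cases b <;> simp [unitVec, axis₁, axis₂, hε]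
  have h := windowGreen_superharmonic a N (x (axis₁ b) - z (axis₁ b)) (x (axis₂ b) - z (axis₂ b))
    (planeMoves b (x :: t))
  refine le_trans (le_of_eq ?_) (mul_le_mul_of_nonneg_right h (windowGreen_nonneg _ _ _ _ _ :
    0 ≤ windowPotential a N z (!b) (x :: t)))
  unfold planeAvg
  simp only [hother _ _ (Or.inl rfl), hother _ _ (Or.inr rfl)]
  unfold windowPotential
  rw [hmoves 1 (by norm_num) _ (Or.inl rfl), hmoves (-1) (by norm_num) _ (Or.inl rfl),
    hmoves 1 (by norm_num) _ (Or.inr rfl), hmoves (-1) (by norm_num) _ (Or.inr rfl)]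
  have e1 : ∀ ε : ℤ, (x + ε • unitVec 4 (axis₁ b)) (axis₁ b) = x (axis₁ b) + ε := by
    intro ε; simp [unitVec]
  have e2 : ∀ ε : ℤ, (x + ε • unitVec 4 (axis₂ b)) (axis₂ b) = x (axis₂ b) + ε := by
    intro ε; simp [unitVec]
  have e3 : ∀ ε : ℤ, (x + ε • unitVec 4 (axis₁ b)) (axis₂ b) = x (axis₂ b) := by
    intro ε; cases b <;> simp [unitVec, axis₁, axis₂]
  have e4 : ∀ ε : ℤ, (x + ε • unitVec 4 (axis₂ b)) (axis₁ b) = x (axis₁ b) := by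
    intro ε; cases b <;> simp [unitVec, axis₁, axis₂]
  simp only [List.headD_cons, e1, e2, e3, e4]
  rw [show x (axis₁ b) + 1 - z (axis₁ b) = x (axis₁ b) - z (axis₁ b) + 1 by ring,
    show x (axis₁ b) + -1 - z (axis₁ b) = x (axis₁ b) - z (axis₁ b) - 1 by ring,
    show x (axis₂ b) + 1 - z (axis₂ b) = x (axis₂ b) - z (axis₂ b) + 1 by ring,
    show x (axis₂ b) + -1 - z (axis₂ b) = x (axis₂ b) - z (axis₂ b) - 1 by ring]
  ring

/-- The probability to visit `z` after at least `a` moves in each plane. -/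
lemma Follows.measureReal_hit_le {Ω : Type*} [MeasurableSpace Ω] {P : Measure Ω}
    [IsProbabilityMeasure P] {S : ℕ → Ω → Fin 4 → ℤ} {w : Bool → List (Fin 4 → ℤ) → ℝ}
    (hS : Follows P S w) (hw : IsRule w) (n a : ℕ) (hn : 1 < n) (ha : 1 ≤ a) (han : a ≤ n)
    (z : Fin 4 → ℤ) :
    P.real {ω | ∃ j ≤ 2 * n, S j ω = z ∧ ∀ b, a ≤ planeMoves b (history (S · ω) j)} ≤
      ((1 + Real.log (4 * n / a)) / (Real.log n / 4)) ^ 2 := by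
  set g := green (2 * n + 1) 0 0 with hg
  have hlog : Real.log n / 4 ≤ g := by
    refine le_trans ?_ (log_le_green n)
    have : (1 : ℝ) ≤ n := by exact_mod_cast hn.le
    gcongr
    linarith
  have hg1 : 1 ≤ g := by
    rw [hg, green, Finset.sum_range_succ', planeKernel_zero_zero]
    linarith [Finset.sum_nonneg fun k (_ : k ∈ Finset.range (2 * n)) =>
      planeKernel_nonneg (k + 1) 0 0]
  have hg0 : 0 < g := by linarith
  set V := windowPotential a (2 * (2 * n)) z with hV
  have hV0 : ∀ b L, 0 ≤ V b L := fun b L => windowGreen_nonneg _ _ _ _ _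
  have hstep : ∀ x t, stepAvg w (fun L => V true L / g * (V false L / g)) x t ≤
      V true (x :: t) / g * (V false (x :: t) / g) := by
    intro x t
    have key : ∀ L, V true L / g * (V false L / g) = (V true L * V false L) / g ^ 2 := by
      intro L; field_simp
    simp only [key]
    refine stepAvg_le_of_planeAvg_le hw fun b => ?_
    have h1 : planeAvg b (fun L => V true L * V false L) x t ≤
        V true (x :: t) * V false (x :: t) := by
      cases b
      · have := planeAvg_windowPotential_le a (2 * (2 * n)) z false x t
        simp only [Bool.not_false, ← hV] at this
        simpa only [mul_comm] using this
      · exact planeAvg_windowPotential_le a (2 * (2 * n)) z true x t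
    refine le_trans (le_of_eq ?_) (div_le_div_of_nonneg_right h1 (by positivity : 0 ≤ g ^ 2))
    unfold planeAvg
    ring
  have hbound : ∀ b, V b [0] / g ≤ (1 + Real.log (4 * n / a)) / g := by
    intro b
    gcongr
    have := windowGreen_zero_le a (2 * (2 * n)) ha (by omega) (0 - z (axis₁ b)) (0 - z (axis₂ b))
    push_cast at this
    rw [show (2 * (2 * n) : ℝ) = 4 * n by ring] at this
    exact this
  have hL0 : 0 ≤ 1 + Real.log (4 * n / a) := by
    have := (hV0 true [0]).trans ((div_le_div_iff_of_pos_right hg0).1 (hbound true))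
    exact this
  calc P.real {ω | ∃ j ≤ 2 * n, S j ω = z ∧ ∀ b, a ≤ planeMoves b (history (S · ω) j)}
      ≤ P.real {ω | ∃ j ≤ 2 * n, (fun L : List (Fin 4 → ℤ) => L.headD 0 = z ∧
          ∀ b, a ≤ planeMoves b L ∧ planeMoves b L ≤ 2 * n) (history (S · ω) j)} := by
        refine measureReal_mono ?_
        rintro ω ⟨j, hj, hz, hb⟩
        refine ⟨j, hj, ?_, fun b => ⟨hb b, (planeMoves_history_le _ _ _).trans hj⟩⟩
        obtain ⟨t, ht⟩ := history_eq_cons (S · ω) j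
        simp [ht, hz]
    _ ≤ V true [0] / g * (V false [0] / g) := by
        refine hS.measureReal_exists_le hw (2 * n) (fun L => V true L / g * (V false L / g))
          (fun L => mul_nonneg (div_nonneg (hV0 _ _) hg0.le) (div_nonneg (hV0 _ _) hg0.le))
          hstep (fun L : List (Fin 4 → ℤ) => L.headD 0 = z ∧
            ∀ b, a ≤ planeMoves b L ∧ planeMoves b L ≤ 2 * n) ?_
        rintro L ⟨hz, hb⟩
        have h1 : ∀ b, 1 ≤ V b L / g := by
          intro b
          rw [one_le_div hg0]
          simp only [hV, windowPotential, hz, sub_self]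
          exact green_le_windowGreen a (2 * n) _ (hb b).1 (hb b).2
        exact one_le_mul_of_one_le_of_one_le (h1 _) (h1 _)
    _ ≤ ((1 + Real.log (4 * n / a)) / g) ^ 2 := by
        rw [sq]
        exact mul_le_mul (hbound _) (hbound _) (div_nonneg (hV0 _ _) hg0.le) (by positivity)
    _ ≤ _ := by
        have : 0 < Real.log n := Real.log_pos (by exact_mod_cast hn)
        gcongr

/-- Few moves in the plane `b` are unlikely after many steps at which such a move has probability
at least `1 / 2`; these steps are counted by `m`. -/
lemma Follows.measureReal_few_moves_le {Ω : Type*} [MeasurableSpace Ω] {P : Measure Ω}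
    [IsProbabilityMeasure P] {S : ℕ → Ω → Fin 4 → ℤ} {w : Bool → List (Fin 4 → ℤ) → ℝ}
    (hS : Follows P S w) (hw : IsRule w) (b : Bool) (m : List (Fin 4 → ℤ) → ℕ) (hm0 : m [] = 0)
    (hm : ∀ x t, m (x :: t) = m t ∨ m (x :: t) = m t + 1 ∧ 1 / 2 ≤ w b (x :: t)) (n a : ℕ) :
    P.real {ω | planeMoves b (history (S · ω) n) < a ∧ 4 * a ≤ m (history (S · ω) n).tail} ≤
      (2 / 3) ^ a := by
  have h := hS.measureReal_le n
    (fun L => (1 / 2 : ℝ) ^ planeMoves b L * (4 / 3) ^ m L.tail)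
    (fun L => by positivity) ?_ (c := (3 / 2) ^ a) (by positivity)
    {ω | planeMoves b (history (S · ω) n) < a ∧ 4 * a ≤ m (history (S · ω) n).tail} ?_
  · refine h.trans (le_of_eq ?_)
    simp only [planeMoves, List.tail_cons, hm0, pow_zero, mul_one]
    rw [one_div, ← inv_pow]
    norm_num
  · intro x t _
    set k := planeMoves b (x :: t) with hk
    have h1 : planeAvg b (fun L => (1 / 2 : ℝ) ^ planeMoves b L * (4 / 3) ^ m L.tail) x t ≤
        (1 / 2) ^ k * (4 / 3) ^ m (x :: t) / 2 := by
      refine planeAvg_le_of_forall fun y _ _ hy => le_of_eq ?_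
      rw [planeMoves_cons_of_ne _ hy, List.tail_cons, pow_succ]
      ring
    have h2 : planeAvg (!b) (fun L => (1 / 2 : ℝ) ^ planeMoves b L * (4 / 3) ^ m L.tail) x t ≤
        (1 / 2) ^ k * (4 / 3) ^ m (x :: t) := by
      refine planeAvg_le_of_forall fun y hy1 hy2 _ => le_of_eq ?_
      rw [Bool.not_not] at hy1 hy2
      rw [planeMoves_cons_of_eq _ hy1 hy2, List.tail_cons]
    have h3 := mul_le_mul_of_nonneg_left h1 (hw.nonneg b (x :: t))
    have h4 := mul_le_mul_of_nonneg_left h2 (hw.nonneg (!b) (x :: t))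
    rw [stepAvg_eq w b]
    refine (add_le_add h3 h4).trans ?_
    have hadd := hw.add_not b (x :: t)
    have h5 : w (!b) (x :: t) = 1 - w b (x :: t) := by linarith
    have h6 := hw.nonneg b (x :: t)
    rw [h5, List.tail_cons]
    have hpos : (0 : ℝ) ≤ (1 / 2) ^ k * (4 / 3) ^ m t := by positivity
    rcases hm x t with hmx | ⟨hmx, hwb⟩
    · rw [hmx]
      nlinarith
    · rw [hmx, pow_succ]
      nlinarith
  · rintro ω ⟨h1, h2⟩
    calc (3 / 2 : ℝ) ^ a ≤ ((1 / 2) * (4 / 3) ^ 4) ^ a := by gcongr; norm_num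
      _ = (1 / 2) ^ a * (4 / 3) ^ (4 * a) := by rw [mul_pow, ← pow_mul]
      _ ≤ _ := by
        gcongr ?_ * ?_
        · exact pow_le_pow_of_le_one (by norm_num) (by norm_num) h1.le
        · exact pow_le_pow_right₀ (by norm_num) h2

lemma Follows.measureReal_few_moves_le_of_half_le {Ω : Type*} [MeasurableSpace Ω] {P : Measure Ω}
    [IsProbabilityMeasure P] {S : ℕ → Ω → Fin 4 → ℤ} {w : Bool → List (Fin 4 → ℤ) → ℝ}
    (hS : Follows P S w) (hw : IsRule w) (b : Bool) (hb : ∀ L, 1 / 2 ≤ w b L) (n a : ℕ)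
    (han : 4 * a ≤ n) :
    P.real {ω | planeMoves b (history (S · ω) n) < a} ≤ (2 / 3) ^ a := by
  refine le_trans (measureReal_mono ?_) (hS.measureReal_few_moves_le hw b List.length rfl
    (fun x t => Or.inr ⟨rfl, hb _⟩) n a)
  intro ω hω
  exact ⟨hω, by simpa [length_history] using han⟩

/-- The number of distinct sites of a trajectory. -/
def siteCount (L : List (Fin 4 → ℤ)) : ℕ := L.toFinset.card

lemma siteCount_cons (x : Fin 4 → ℤ) (t : List (Fin 4 → ℤ)) :
    siteCount (x :: t) = if x ∈ t then siteCount t else siteCount t + 1 := by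
  unfold siteCount
  rw [List.toFinset_cons]
  split_ifs with h
  · rw [Finset.insert_eq_of_mem (by simpa using h)]
  · rw [Finset.card_insert_of_notMem (by simpa using h)]

/-- The number of pairs of (not necessarily distinct) times at which a trajectory is at the same
site. -/
def visitPairs : List (Fin 4 → ℤ) → ℕ
  | [] => 0
  | x :: t => visitPairs t + (t.count x + 1)

lemma sum_sq_count_add_length (s : Finset (Fin 4 → ℤ)) (L : List (Fin 4 → ℤ))
    (h : ∀ x ∈ L, x ∈ s) : ∑ z ∈ s, L.count z ^ 2 + L.length = 2 * visitPairs L := by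
  induction L with
  | nil => simp [visitPairs]
  | cons x t ih =>
    have ih' := ih fun y hy => h y (List.mem_cons_of_mem _ hy)
    have hx := h x List.mem_cons_self
    have h1 : ∀ z, (x :: t).count z ^ 2 =
        t.count z ^ 2 + if x = z then 2 * t.count z + 1 else 0 := by
      intro z
      rw [List.count_cons]
      by_cases hz : x = z <;> simp [hz]
      ring
    simp only [h1, Finset.sum_add_distrib, Finset.sum_ite_eq, hx, if_true, visitPairs,
      List.length_cons]
    omega

lemma sq_length_le_siteCount_mul (L : List (Fin 4 → ℤ)) :
    L.length ^ 2 ≤ siteCount L * (2 * visitPairs L) := by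
  have h := sum_sq_count_add_length L.toFinset L (by simp)
  calc L.length ^ 2 = (∑ z ∈ L.toFinset, L.count z) ^ 2 := by
        rw [List.sum_toFinset_count_eq_length]
    _ ≤ L.toFinset.card * ∑ z ∈ L.toFinset, L.count z ^ 2 := sq_sum_le_card_mul_sum_sq
    _ ≤ _ := Nat.mul_le_mul le_rfl (by omega)

/-- The Green functions of the projection to the plane `b`, seen from `x` and summed over the
sites of `L`. -/
noncomputable def greenSum (b : Bool) (r : ℕ) (x : Fin 4 → ℤ) (L : List (Fin 4 → ℤ)) : ℝ :=
  (L.map fun z => green r (x (axis₁ b) - z (axis₁ b)) (x (axis₂ b) - z (axis₂ b))).sum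

lemma greenSum_cons (b : Bool) (r : ℕ) (x y : Fin 4 → ℤ) (L : List (Fin 4 → ℤ)) :
    greenSum b r x (y :: L) =
      green r (x (axis₁ b) - y (axis₁ b)) (x (axis₂ b) - y (axis₂ b)) + greenSum b r x L := by
  simp [greenSum]

lemma greenSum_nonneg (b : Bool) (r : ℕ) (x : Fin 4 → ℤ) (L : List (Fin 4 → ℤ)) :
    0 ≤ greenSum b r x L := by
  refine List.sum_nonneg fun c hc => ?_
  obtain ⟨z, _, rfl⟩ := List.mem_map.1 hc
  exact green_nonneg _ _ _

lemma greenSum_mono (b : Bool) {r s : ℕ} (h : r ≤ s) (x : Fin 4 → ℤ) (L : List (Fin 4 → ℤ)) :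
    greenSum b r x L ≤ greenSum b s x L :=
  List.sum_le_sum fun _ _ => green_mono h _ _

lemma greenSum_congr (b : Bool) (r : ℕ) {x y : Fin 4 → ℤ} (L : List (Fin 4 → ℤ))
    (h₁ : y (axis₁ b) = x (axis₁ b)) (h₂ : y (axis₂ b) = x (axis₂ b)) :
    greenSum b r y L = greenSum b r x L := by
  simp [greenSum, h₁, h₂]

lemma avg_greenSum_add_count_le (b : Bool) (r : ℕ) (x : Fin 4 → ℤ) (L : List (Fin 4 → ℤ)) :
    (greenSum b r (x + (1 : ℤ) • unitVec 4 (axis₁ b)) L +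
      greenSum b r (x + (-1 : ℤ) • unitVec 4 (axis₁ b)) L +
      greenSum b r (x + (1 : ℤ) • unitVec 4 (axis₂ b)) L +
      greenSum b r (x + (-1 : ℤ) • unitVec 4 (axis₂ b)) L) / 4 + L.count x ≤
      greenSum b (r + 1) x L := by
  induction L with
  | nil => simp [greenSum]
  | cons z L ih =>
    simp only [greenSum_cons]
    have e1 : ∀ ε : ℤ, (x + ε • unitVec 4 (axis₁ b)) (axis₁ b) = x (axis₁ b) + ε := by
      intro ε; simp [unitVec]
    have e2 : ∀ ε : ℤ, (x + ε • unitVec 4 (axis₂ b)) (axis₂ b) = x (axis₂ b) + ε := by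
      intro ε; simp [unitVec]
    have e3 : ∀ ε : ℤ, (x + ε • unitVec 4 (axis₁ b)) (axis₂ b) = x (axis₂ b) := by
      intro ε; cases b <;> simp [unitVec, axis₁, axis₂]
    have e4 : ∀ ε : ℤ, (x + ε • unitVec 4 (axis₂ b)) (axis₁ b) = x (axis₁ b) := by
      intro ε; cases b <;> simp [unitVec, axis₁, axis₂]
    simp only [e1, e2, e3, e4]
    rw [show x (axis₁ b) + 1 - z (axis₁ b) = x (axis₁ b) - z (axis₁ b) + 1 by ring,
      show x (axis₁ b) + -1 - z (axis₁ b) = x (axis₁ b) - z (axis₁ b) - 1 by ring,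
      show x (axis₂ b) + 1 - z (axis₂ b) = x (axis₂ b) - z (axis₂ b) + 1 by ring,
      show x (axis₂ b) + -1 - z (axis₂ b) = x (axis₂ b) - z (axis₂ b) - 1 by ring, green_succ,
      List.count_cons]
    have h0 : ((if z == x then 1 else 0 : ℕ) : ℝ) ≤
        planeKernel 0 (x (axis₁ b) - z (axis₁ b)) (x (axis₂ b) - z (axis₂ b)) := by
      by_cases hzx : z = x
      · subst hzx
        simp [planeKernel_zero_zero]
      · simpa [hzx] using planeKernel_nonneg _ _ _
    push_cast at h0 ⊢
    linarith

/-- If moves in the plane `b` have probability at least `1 / 2`, the trajectory does not revisit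
its sites too often. -/
lemma Follows.measureReal_visitPairs_ge_le {Ω : Type*} [MeasurableSpace Ω] {P : Measure Ω}
    [IsProbabilityMeasure P] {S : ℕ → Ω → Fin 4 → ℤ} {w : Bool → List (Fin 4 → ℤ) → ℝ}
    (hS : Follows P S w) (hw : IsRule w) (b : Bool) (hb : ∀ L, 1 / 2 ≤ w b L) (n : ℕ) {c : ℝ}
    (hc : 0 < c) :
    P.real {ω | c ≤ visitPairs (history (S · ω) n).tail} ≤
      2 * (n + 1) * green (n + 1) 0 0 / c := by
  set g := green (n + 1) 0 0 with hg
  have hg0 : 0 ≤ g := green_nonneg _ _ _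
  set W : List (Fin 4 → ℤ) → ℝ := fun L => visitPairs L.tail +
    2 * greenSum b (n + 1 - L.length) (L.headD 0) L + 2 * (n + 1 - L.length : ℕ) * g with hW
  have hGS := greenSum_nonneg b
  have hW0 : ∀ L, 0 ≤ W L := fun L => by
    have := hGS (n + 1 - L.length) (L.headD 0) L
    positivity
  refine (hS.measureReal_le n W hW0 ?_ hc {ω | c ≤ visitPairs (history (S · ω) n).tail}
    ?_).trans ?_
  · intro x t hxt
    obtain ⟨r, hr⟩ : ∃ r, n + 1 - (x :: t).length = r + 1 := ⟨n - (x :: t).length, by omega⟩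
    have hrn : n + 1 - ((x :: t).length + 1) = r := by omega
    have hgr : green r 0 0 ≤ g := green_mono (by omega) _ _
    set K : ℝ := visitPairs (x :: t) + 2 * (r + 1) * g with hK
    have hcons : ∀ y, W (y :: x :: t) ≤ K + 2 * greenSum b r y (x :: t) := by
      intro y
      simp only [hW]
      rw [List.tail_cons, List.headD_cons, List.length_cons, hrn, greenSum_cons, sub_self,
        sub_self]
      linarith
    have h1 : planeAvg b W x t ≤ K + 2 * (greenSum b (r + 1) x (x :: t) - (x :: t).count x) := by
      have := avg_greenSum_add_count_le b r x (x :: t)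
      unfold planeAvg
      linarith [hcons (x + (1 : ℤ) • unitVec 4 (axis₁ b)),
        hcons (x + (-1 : ℤ) • unitVec 4 (axis₁ b)), hcons (x + (1 : ℤ) • unitVec 4 (axis₂ b)),
        hcons (x + (-1 : ℤ) • unitVec 4 (axis₂ b))]
    have h2 : planeAvg (!b) W x t ≤ K + 2 * greenSum b (r + 1) x (x :: t) := by
      refine planeAvg_le_of_forall fun y hy1 hy2 _ => (hcons y).trans ?_
      rw [Bool.not_not] at hy1 hy2
      rw [greenSum_congr b r _ hy1 hy2]
      linarith [greenSum_mono b (Nat.le_succ r) x (x :: t)]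
    have hWx : W (x :: t) = visitPairs t + 2 * greenSum b (r + 1) x (x :: t) +
        2 * (r + 1) * g := by
      simp only [hW]
      rw [List.tail_cons, List.headD_cons, hr]
      push_cast
      ring
    have hKx : K = visitPairs t + (x :: t).count x + 2 * (r + 1) * g := by
      rw [hK, visitPairs, List.count_cons_self]
      push_cast
      ring
    have h3 := mul_le_mul_of_nonneg_left h1 (hw.nonneg b (x :: t))
    have h4 := mul_le_mul_of_nonneg_left h2 (hw.nonneg (!b) (x :: t))
    have hadd := hw.add_not b (x :: t)
    have h5 : w (!b) (x :: t) = 1 - w b (x :: t) := by linarith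
    rw [stepAvg_eq w b]
    refine (add_le_add h3 h4).trans ?_
    rw [h5, hWx, hKx]
    have h6 := hb (x :: t)
    have h7 : (0 : ℝ) ≤ (x :: t).count x := Nat.cast_nonneg _
    nlinarith
  · intro ω hω
    refine le_trans (show c ≤ visitPairs (history (S · ω) n).tail from hω) ?_
    simp only [hW]
    have := hGS (n + 1 - (history (S · ω) n).length) ((history (S · ω) n).headD 0)
      (history (S · ω) n)
    have h2 : (0 : ℝ) ≤ (n + 1 - (history (S · ω) n).length : ℕ) * g := by positivity
    linarith
  · gcongr
    simp only [hW, visitPairs, List.tail_cons, List.headD_cons, List.length_singleton,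
      Nat.add_sub_cancel, Nat.cast_zero, zero_add]
    have : greenSum b n 0 [0] ≤ g := by
      simp only [greenSum, List.map_cons, List.map_nil, List.sum_singleton, sub_self]
      exact green_mono (by omega) _ _
    linarith

open Classical in
/-- A weight measuring how close the walk is to being able to move in the plane `false`, when the
first visit to a site triggers a move in the plane `true`. -/
noncomputable def returnWeight (L : List (Fin 4 → ℤ)) : ℝ :=
  if L.headD 0 ∈ L.tail then 0.8 else
    if ∃ i, (i = axis₁ true ∨ i = axis₂ true) ∧ ∃ ε : ℤ, (ε = 1 ∨ ε = -1) ∧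
      L.headD 0 + ε • unitVec 4 i ∈ L.tail then 1 else 1.04

lemma returnWeight_cons_of_mem {x : Fin 4 → ℤ} {t : List (Fin 4 → ℤ)} (h : x ∈ t) :
    returnWeight (x :: t) = 0.8 := by
  simp [returnWeight, h]

lemma le_returnWeight (L : List (Fin 4 → ℤ)) : 0.8 ≤ returnWeight L := by
  unfold returnWeight; split_ifs <;> norm_num

lemma returnWeight_le (L : List (Fin 4 → ℤ)) : returnWeight L ≤ 1.04 := by
  unfold returnWeight; split_ifs <;> norm_num

lemma returnWeight_neighbor_le {x : Fin 4 → ℤ} (t : List (Fin 4 → ℤ)) {i : Fin 4}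
    (hi : i = axis₁ true ∨ i = axis₂ true) {ε : ℤ} (hε : ε = 1 ∨ ε = -1) :
    returnWeight ((x + ε • unitVec 4 i) :: x :: t) ≤ 1 := by
  unfold returnWeight
  split_ifs with h1 h2
  · norm_num
  · exact le_rfl
  · refine absurd ⟨i, hi, -ε, by omega, ?_⟩ h2
    simp

lemma planeAvg_returnWeight_le_one (x : Fin 4 → ℤ) (t : List (Fin 4 → ℤ)) :
    planeAvg true returnWeight x t ≤ 1 := by
  unfold planeAvg
  linarith [returnWeight_neighbor_le (x := x) t (Or.inl rfl) (ε := 1) (Or.inl rfl),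
    returnWeight_neighbor_le (x := x) t (Or.inl rfl) (ε := -1) (Or.inr rfl),
    returnWeight_neighbor_le (x := x) t (Or.inr rfl) (ε := 1) (Or.inl rfl),
    returnWeight_neighbor_le (x := x) t (Or.inr rfl) (ε := -1) (Or.inr rfl)]

lemma planeAvg_returnWeight_le (x : Fin 4 → ℤ) (t : List (Fin 4 → ℤ)) (hx : x ∉ t) :
    1.04 * planeAvg true returnWeight x t ≤ returnWeight (x :: t) := by
  by_cases h : ∃ i, (i = axis₁ true ∨ i = axis₂ true) ∧ ∃ ε : ℤ, (ε = 1 ∨ ε = -1) ∧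
      x + ε • unitVec 4 i ∈ t
  · have h1 : returnWeight (x :: t) = 1 := by
      unfold returnWeight
      rw [if_neg (by simpa using hx), if_pos (by simpa using h)]
    have hle : planeAvg true returnWeight x t ≤ 0.95 := by
      have a1 := returnWeight_neighbor_le (x := x) t (Or.inl rfl) (ε := 1) (Or.inl rfl)
      have a2 := returnWeight_neighbor_le (x := x) t (Or.inl rfl) (ε := -1) (Or.inr rfl)
      have a3 := returnWeight_neighbor_le (x := x) t (Or.inr rfl) (ε := 1) (Or.inl rfl)
      have a4 := returnWeight_neighbor_le (x := x) t (Or.inr rfl) (ε := -1) (Or.inr rfl)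
      obtain ⟨i, hi, ε, hε, hmem⟩ := h
      have h2 := returnWeight_cons_of_mem (List.mem_cons_of_mem x hmem)
      unfold planeAvg
      rcases hi with rfl | rfl <;> rcases hε with rfl | rfl <;> linarith
    rw [h1]
    linarith
  · have h1 : returnWeight (x :: t) = 1.04 := by
      unfold returnWeight
      rw [if_neg (by simpa using hx), if_neg (by simpa using h)]
    rw [h1]
    linarith [planeAvg_returnWeight_le_one x t]

lemma Follows.measureReal_few_moves_le_of_return {Ω : Type*} [MeasurableSpace Ω] {P : Measure Ω}
    [IsProbabilityMeasure P] {S : ℕ → Ω → Fin 4 → ℤ} (hS : Follows P S (visitRule (1 / 2) 1))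
    (n a : ℕ) (han : 50 * a ≤ n) :
    P.real {ω | planeMoves false (history (S · ω) n) < a} ≤ 2 * (2 / 3) ^ a := by
  set f : List (Fin 4 → ℤ) → ℝ := fun L =>
    (1 / 2 : ℝ) ^ planeMoves false L * 1.04 ^ L.tail.length * returnWeight L with hf
  have hw0 : ∀ L, 0 ≤ returnWeight L := fun L => by linarith [le_returnWeight L]
  have h := hS.measureReal_le n f (fun L => by have := hw0 L; positivity) ?_
    (c := 0.8 * (3 / 2) ^ a) (by positivity)
    {ω | planeMoves false (history (S · ω) n) < a} ?_
  · refine h.trans ?_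
    have h1 := returnWeight_le [0]
    have h2 : f [0] = returnWeight [0] := by simp [hf, planeMoves]
    rw [h2, div_le_iff₀ (by positivity)]
    have h3 : (2 / 3 : ℝ) ^ a * (3 / 2) ^ a = 1 := by rw [← mul_pow]; norm_num
    calc returnWeight [0] ≤ 1.04 := h1
      _ ≤ 1.6 * ((2 / 3 : ℝ) ^ a * (3 / 2) ^ a) := by rw [h3]; norm_num
      _ = _ := by ring
  · intro x t _
    set k := planeMoves false (x :: t) with hk
    set D : ℝ := (1 / 2 : ℝ) ^ k * 1.04 ^ t.length with hD
    have hD0 : 0 ≤ D := by positivity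
    have hx : f (x :: t) = D * returnWeight (x :: t) := by simp [hf, hD, hk]
    have h1 : planeAvg true f x t = D * 1.04 * planeAvg true returnWeight x t := by
      have key : ∀ ε : ℤ, ∀ i, (i = axis₁ true ∨ i = axis₂ true) →
          f ((x + ε • unitVec 4 i) :: x :: t) =
            D * 1.04 * returnWeight ((x + ε • unitVec 4 i) :: x :: t) := by
        intro ε i hi
        simp only [hf, List.tail_cons, List.length_cons, pow_succ]
        rw [planeMoves_cons_of_eq]
        · ring
        all_goals rcases hi with rfl | rfl <;> simp [unitVec, axis₁, axis₂]
      unfold planeAvg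
      rw [key _ _ (Or.inl rfl), key _ _ (Or.inl rfl), key _ _ (Or.inr rfl), key _ _ (Or.inr rfl)]
      ring
    have h2 : planeAvg false f x t ≤ D * 1.04 * 0.52 := by
      refine planeAvg_le_of_forall fun y _ _ hy => ?_
      simp only [hf, List.tail_cons, List.length_cons, pow_succ]
      rw [planeMoves_cons_of_ne _ hy, pow_succ]
      have := mul_le_mul_of_nonneg_left (returnWeight_le (y :: x :: t)) hD0
      rw [hD] at this ⊢
      linarith
    rw [hx]
    by_cases hxt : x ∈ t
    · simp only [stepAvg, visitRule_cons_of_mem hxt, returnWeight_cons_of_mem hxt, h1]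
      have := mul_le_mul_of_nonneg_left (planeAvg_returnWeight_le_one x t) hD0
      norm_num
      linarith
    · simp only [stepAvg, visitRule_cons_of_notMem hxt, h1]
      have := mul_le_mul_of_nonneg_left (planeAvg_returnWeight_le x t hxt) hD0
      norm_num at this ⊢
      linarith
  · intro ω hω
    have hlen : (history (S · ω) n).tail.length = n := by simp [length_history]
    have h3 : (3 : ℝ) ≤ 1.04 ^ 50 := by norm_num
    calc (0.8 * (3 / 2) ^ a : ℝ) = (1 / 2) ^ a * 3 ^ a * 0.8 := by
          rw [← mul_pow]; norm_num; ring
      _ ≤ (1 / 2) ^ a * (1.04 ^ 50) ^ a * 0.8 := by gcongr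
      _ = (1 / 2) ^ a * 1.04 ^ (50 * a) * 0.8 := by rw [pow_mul]
      _ ≤ f (history (S · ω) n) := by
        simp only [hf, hlen]
        refine mul_le_mul (mul_le_mul ?_ ?_ (by positivity) (by positivity)) (le_returnWeight _)
          (by norm_num) (by positivity)
        · exact pow_le_pow_of_le_one (by norm_num) (by norm_num) (le_of_lt hω)
        · exact pow_le_pow_right₀ (by norm_num) han

lemma two_thirds_pow_le (a : ℕ) (ha : 1 ≤ a) : (2 / 3 : ℝ) ^ a ≤ 2 / a := by
  have ha0 : (0 : ℝ) < a := by exact_mod_cast ha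
  have h := one_add_mul_le_pow (show (-2 : ℝ) ≤ 1 / 2 by norm_num) a
  norm_num at h
  have h2 : (2 / 3 : ℝ) ^ a * (3 / 2) ^ a = 1 := by rw [← mul_pow]; norm_num
  have h3 : (0 : ℝ) < (2 / 3) ^ a := by positivity
  rw [le_div_iff₀ ha0]
  nlinarith

lemma Follows.measureReal_window_le {Ω : Type*} [MeasurableSpace Ω] {P : Measure Ω}
    [IsProbabilityMeasure P] {S : ℕ → Ω → Fin 4 → ℤ} {w : Bool → List (Fin 4 → ℤ) → ℝ}
    (hS : Follows P S w) (hw : IsRule w) (n a : ℕ) (hn : 1 < n) (ha : 1 ≤ a) (han : a ≤ n)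
    (z : Fin 4 → ℤ) :
    P.real {ω | ∃ k, n ≤ k ∧ k ≤ 2 * n ∧ S k ω = z} ≤
      P.real {ω | planeMoves true (history (S · ω) n) < a} +
        P.real {ω | planeMoves false (history (S · ω) n) < a} +
        ((1 + Real.log (4 * n / a)) / (Real.log n / 4)) ^ 2 := by
  refine le_trans (measureReal_mono ?_) ((measureReal_union_le _ _).trans
    (add_le_add (measureReal_union_le _ _) (hS.measureReal_hit_le hw n a hn ha han z)))
  rintro ω ⟨k, hnk, hk, hz⟩
  by_cases h1 : planeMoves true (history (S · ω) n) < a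
  · exact Or.inl (Or.inl h1)
  by_cases h2 : planeMoves false (history (S · ω) n) < a
  · exact Or.inl (Or.inr h2)
  refine Or.inr ⟨k, hk, hz, fun b => le_trans ?_ (planeMoves_history_mono b _ hnk)⟩
  cases b
  exacts [not_lt.1 h2, not_lt.1 h1]

lemma measureReal_few_moves_le_of_isBERW_four_two {Ω : Type*} [MeasurableSpace Ω] {P : Measure Ω}
    [IsProbabilityMeasure P] {S : ℕ → Ω → Fin 4 → ℤ} (hS : Follows P S (visitRule 0 (1 / 2)))
    (n a : ℕ) (hn : 1 ≤ n) (ha : 1 ≤ a) :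
    P.real {ω | planeMoves true (history (S · ω) n) < a} ≤
      (2 / 3) ^ a + 32 * a * (2 + Real.log n) / n := by
  have hw : IsRule (visitRule 0 (1 / 2)) := isRule_visitRule (by simp) (by norm_num)
  have hhalf : ∀ L, 1 / 2 ≤ visitRule 0 (1 / 2) false L := by
    intro L; unfold visitRule; split_ifs <;> norm_num at *
  have hn0 : (0 : ℝ) < n := by exact_mod_cast hn
  have ha0 : (0 : ℝ) < a := by exact_mod_cast ha
  have h1 := hS.measureReal_few_moves_le hw true siteCount rfl (fun x t => by
    rw [siteCount_cons]
    split_ifs with hx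
    · exact Or.inl rfl
    · exact Or.inr ⟨rfl, by rw [visitRule_cons_of_notMem hx]; norm_num⟩) n a
  have h2 := hS.measureReal_visitPairs_ge_le hw false hhalf n
    (c := (n : ℝ) ^ 2 / (8 * a)) (by positivity)
  refine le_trans (measureReal_mono ?_) ((measureReal_union_le _ _).trans (add_le_add h1
    (h2.trans ?_)))
  · intro ω hω
    by_cases hs : 4 * a ≤ siteCount (history (S · ω) n).tail
    · exact Or.inl ⟨hω, hs⟩
    · refine Or.inr ?_
      change (n : ℝ) ^ 2 / (8 * a) ≤ visitPairs (history (S · ω) n).tail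
      have h3 := sq_length_le_siteCount_mul (history (S · ω) n).tail
      rw [List.length_tail, length_history, Nat.add_sub_cancel] at h3
      have h4 : n ^ 2 ≤ 4 * a * (2 * visitPairs (history (S · ω) n).tail) :=
        h3.trans (Nat.mul_le_mul (by omega) le_rfl)
      rw [div_le_iff₀ (by positivity)]
      have h5 : ((n ^ 2 : ℕ) : ℝ) ≤ (4 * a * (2 * visitPairs (history (S · ω) n).tail) : ℕ) :=
        Nat.cast_le.2 h4
      push_cast at h5
      linarith
  · have hg := green_zero_zero_le n hn
    have hg0 := green_nonneg (n + 1) 0 0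
    have hn1 : (1 : ℝ) ≤ n := by exact_mod_cast hn
    calc 2 * (n + 1) * green (n + 1) 0 0 / ((n : ℝ) ^ 2 / (8 * a))
        ≤ 2 * (n + n) * (2 + Real.log n) / ((n : ℝ) ^ 2 / (8 * a)) := by gcongr
      _ = _ := by field_simp; ring

lemma measureReal_window_le_of_isBERW {Ω : Type*} [MeasurableSpace Ω] {P : Measure Ω}
    [IsProbabilityMeasure P] {S : ℕ → Ω → Fin 4 → ℤ}
    (hS : IsBERW 4 4 2 P S ∨ IsBERW 4 2 4 P S) (n a : ℕ) (hn : 1 < n) (ha : 1 ≤ a)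
    (han : 50 * a ≤ n) (z : Fin 4 → ℤ) :
    P.real {ω | ∃ k, n ≤ k ∧ k ≤ 2 * n ∧ S k ω = z} ≤
      3 * (2 / 3) ^ a + 32 * a * (2 + Real.log n) / n +
        ((1 + Real.log (4 * n / a)) / (Real.log n / 4)) ^ 2 := by
  have hpos : (0 : ℝ) < (2 / 3) ^ a := by positivity
  have hlog : 0 ≤ Real.log n := Real.log_natCast_nonneg n
  have hpos2 : 0 ≤ 32 * a * (2 + Real.log n) / n := by positivity
  rcases hS with hS | hS
  · have hF := follows_of_isBERW_four_two hS
    have hw : IsRule (visitRule 0 (1 / 2)) := isRule_visitRule (by simp) (by norm_num)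
    have h1 := hF.measureReal_window_le hw n a hn ha (by omega) z
    have h2 := measureReal_few_moves_le_of_isBERW_four_two hF n a hn.le ha
    have h3 := hF.measureReal_few_moves_le_of_half_le hw false (fun L => by
      unfold visitRule; split_ifs <;> norm_num at *) n a (by omega)
    linarith
  · have hF := follows_of_isBERW_two_four hS
    have hw : IsRule (visitRule (1 / 2) 1) := isRule_visitRule (by norm_num) (by simp)
    have h1 := hF.measureReal_window_le hw n a hn ha (by omega) z
    have h2 := hF.measureReal_few_moves_le_of_return n a han
    have h3 := hF.measureReal_few_moves_le_of_half_le hw true (fun L => by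
      unfold visitRule; split_ifs <;> norm_num at *) n a (by omega)
    linarith

lemma log_log_div_log_ne_zero (n : ℕ) (hn : 1 < n) :
    Real.log (Real.log n) / Real.log n ≠ 0 := by
  have h0 : 0 < Real.log n := Real.log_pos (by exact_mod_cast hn)
  refine div_ne_zero ?_ h0.ne'
  refine Real.log_ne_zero_of_pos_of_ne_one h0 fun h1 => ?_
  have h2 : (n : ℝ) = Real.exp 1 := by
    rw [← h1, Real.exp_log (by exact_mod_cast (by omega : 0 < n))]
  have h3 := Real.exp_one_gt_d9
  have h4 := Real.exp_one_lt_d9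
  rw [← h2] at h3 h4
  have h5 : 2 < n := by exact_mod_cast (by linarith : (2 : ℝ) < n)
  have h6 : n < 3 := by exact_mod_cast (by linarith : (n : ℝ) < 3)
  omega

lemma eventually_window_bound_le : ∀ᶠ n : ℕ in atTop, ∃ a : ℕ, 1 ≤ a ∧ 50 * a ≤ n ∧
    3 * (2 / 3 : ℝ) ^ a + 32 * a * (2 + Real.log n) / n +
        ((1 + Real.log (4 * n / a)) / (Real.log n / 4)) ^ 2 ≤
      854 * (Real.log (Real.log n) / Real.log n) ^ 2 := by
  have hlog : Tendsto (fun n : ℕ => Real.log n) atTop atTop :=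
    Real.tendsto_log_atTop.comp tendsto_natCast_atTop_atTop
  have ho : ∀ᶠ n : ℕ in atTop, Real.log n ^ 5 ≤ 1 / 2 * n := by
    have h := (Real.isLittleO_pow_log_id_atTop (n := 5)).bound (show (0 : ℝ) < 1 / 2 by norm_num)
    filter_upwards [tendsto_natCast_atTop_atTop.eventually h] with n hn
    simp only [id, Real.norm_eq_abs, Nat.abs_cast] at hn
    exact (le_abs_self _).trans hn
  filter_upwards [hlog.eventually_ge_atTop 50, ho, eventually_ge_atTop 1] with n hl hn5 hn1
  set l := Real.log n with hl_def
  have hn0 : (0 : ℝ) < n := by exact_mod_cast hn1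
  have hl0 : 0 < l := by linarith
  have hq : 2 * l ^ 2 ≤ n / l ^ 3 := by
    rw [le_div_iff₀ (by positivity)]
    nlinarith
  have hl2 : 1 ≤ l ^ 2 := by nlinarith
  set a := ⌊(n : ℝ) / l ^ 3⌋₊ with ha
  have hale : (a : ℝ) ≤ n / l ^ 3 := Nat.floor_le (by positivity)
  have halt : (n : ℝ) / l ^ 3 < a + 1 := Nat.lt_floor_add_one _
  have hal : l ^ 2 ≤ a := by linarith
  have ha1 : (1 : ℝ) ≤ a := by linarith
  have hahalf : n / (2 * l ^ 3) ≤ a := by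
    have : n / (2 * l ^ 3) = n / l ^ 3 / 2 := by field_simp
    linarith
  have hl3 : 50 ≤ l ^ 3 := by nlinarith
  have ha1' : 1 ≤ a := by exact_mod_cast ha1
  have hLL : 1 ≤ Real.log l := by
    rw [Real.le_log_iff_exp_le hl0]
    linarith [Real.exp_one_lt_d9]
  refine ⟨a, ha1', ?_, ?_⟩
  · have h1 := (le_div_iff₀ (by positivity)).1 hale
    have h2 : (50 * a : ℝ) ≤ n := by nlinarith
    exact_mod_cast h2
  · set c := Real.log l with hc
    have b1 : 3 * (2 / 3 : ℝ) ^ a ≤ 6 * (c / l) ^ 2 := by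
      have h1 := two_thirds_pow_le a ha1'
      have h2 : (2 : ℝ) / a ≤ 2 / l ^ 2 := by gcongr
      have h3 : (1 : ℝ) ≤ c ^ 2 := by nlinarith
      calc 3 * (2 / 3 : ℝ) ^ a ≤ 6 * (1 / l ^ 2) := by
            have : (2 : ℝ) / l ^ 2 = 2 * (1 / l ^ 2) := by ring
            linarith
        _ ≤ 6 * (c ^ 2 / l ^ 2) := by gcongr
        _ = _ := by rw [div_pow]
    have b2 : 32 * a * (2 + l) / n ≤ 64 * (c / l) ^ 2 := by
      have h3 : (1 : ℝ) ≤ c ^ 2 := by nlinarith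
      calc 32 * a * (2 + l) / n ≤ 32 * (n / l ^ 3) * (l + l) / n := by
            gcongr
            linarith
        _ = 64 * (1 / l ^ 2) := by field_simp; ring
        _ ≤ 64 * (c ^ 2 / l ^ 2) := by gcongr
        _ = _ := by rw [div_pow]
    have b3 : ((1 + Real.log (4 * n / a)) / (l / 4)) ^ 2 ≤ 784 * (c / l) ^ 2 := by
      have h4 : 4 * n / a ≤ 8 * l ^ 3 := by
        rw [div_le_iff₀ (by linarith)]
        rw [div_le_iff₀ (by positivity)] at hahalf
        linarith
      have h8 : Real.log 8 ≤ 3 := by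
        rw [Real.log_le_iff_le_exp (by norm_num)]
        have h9 := Real.exp_one_gt_d9
        calc (8 : ℝ) = 2 ^ 3 := by norm_num
          _ ≤ Real.exp 1 ^ 3 := by gcongr; linarith
          _ = Real.exp 3 := by rw [← Real.exp_nat_mul]; norm_num
      have h5 : Real.log (4 * n / a) ≤ 3 + 3 * c := by
        refine (Real.log_le_log (by positivity) h4).trans ?_
        rw [Real.log_mul (by norm_num) (by positivity), Real.log_pow]
        push_cast
        linarith
      have h6 : 0 ≤ Real.log (4 * n / a) := by
        refine Real.log_nonneg ?_
        rw [one_le_div (by linarith)]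
        have := (le_div_iff₀ (by positivity)).1 hale
        nlinarith
      calc ((1 + Real.log (4 * n / a)) / (l / 4)) ^ 2 ≤ (7 * c / (l / 4)) ^ 2 := by
            gcongr
            linarith
        _ = _ := by field_simp; ring
    linarith

lemma exists_measureReal_window_le {Ω : Type*} [MeasurableSpace Ω] {P : Measure Ω}
    [IsProbabilityMeasure P] {S : ℕ → Ω → Fin 4 → ℤ}
    (hS : IsBERW 4 4 2 P S ∨ IsBERW 4 2 4 P S) :
    ∃ C : ℝ, 0 < C ∧ ∀ (z : Fin 4 → ℤ) (n : ℕ), 1 < n →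
      P.real {ω | ∃ k, n ≤ k ∧ k ≤ 2 * n ∧ S k ω = z} ≤
        C * (Real.log (Real.log n) / Real.log n) ^ 2 := by
  obtain ⟨N, hN⟩ := eventually_atTop.1 eventually_window_bound_le
  set r : ℕ → ℝ := fun n => (Real.log (Real.log n) / Real.log n) ^ 2 with hr
  have hr0 : ∀ n, 0 ≤ r n := fun n => sq_nonneg _
  have hsum : 0 ≤ ∑ n ∈ Finset.range N, (r n)⁻¹ :=
    Finset.sum_nonneg fun n _ => inv_nonneg.2 (hr0 n)
  refine ⟨854 + ∑ n ∈ Finset.range N, (r n)⁻¹, by linarith, fun z n hn => ?_⟩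
  change _ ≤ _ * r n
  rw [add_mul]
  rcases lt_or_ge n N with h | h
  · have hpos : 0 < r n := by
      have := log_log_div_log_ne_zero n hn
      positivity
    have h1 : (r n)⁻¹ ≤ ∑ n ∈ Finset.range N, (r n)⁻¹ :=
      Finset.single_le_sum (f := fun n => (r n)⁻¹) (fun n _ => inv_nonneg.2 (hr0 n))
        (Finset.mem_range.2 h)
    have h2 := mul_le_mul_of_nonneg_right h1 (hr0 n)
    rw [inv_mul_cancel₀ hpos.ne'] at h2
    have h3 : P.real {ω | ∃ k, n ≤ k ∧ k ≤ 2 * n ∧ S k ω = z} ≤ 1 := measureReal_le_one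
    linarith
  · obtain ⟨a, ha, han, hle⟩ := hN n h
    have h1 := measureReal_window_le_of_isBERW hS n a hn ha han z
    have h2 := mul_nonneg hsum (hr0 n)
    exact (h1.trans hle).trans (by simp only [hr] at h2 ⊢; linarith)

lemma summable_log_log_dyadic :
    Summable fun k : ℕ => (Real.log (Real.log (2 ^ k : ℕ)) / Real.log (2 ^ k : ℕ)) ^ 2 := by
  have hl2 : 0 < Real.log 2 := Real.log_pos (by norm_num)
  have hs : Summable fun k : ℕ => 16 * Real.log 2 ^ (-(3 / 2) : ℝ) * (k : ℝ) ^ (-(3 / 2) : ℝ) :=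
    (Real.summable_nat_rpow.2 (by norm_num)).mul_left _
  refine hs.of_norm_bounded_eventually_nat ?_
  filter_upwards [eventually_ge_atTop 2] with k hk
  have hk2 : (2 : ℝ) ≤ k := by exact_mod_cast hk
  push_cast
  rw [Real.log_pow, Real.norm_of_nonneg (sq_nonneg _), mul_comm (k : ℝ) (Real.log 2), mul_assoc,
    ← Real.mul_rpow hl2.le (by positivity)]
  set x := Real.log 2 * k with hx
  have hx1 : 1 ≤ x := by nlinarith [Real.log_two_gt_d9]
  have hx0 : 0 < x := by linarith
  have h1 := Real.log_le_rpow_div hx0.le (show (0 : ℝ) < 1 / 4 by norm_num)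
  have h0 : 0 ≤ Real.log x := Real.log_nonneg hx1
  have h2 : x ^ (-(3 / 2) : ℝ) = (x ^ (1 / 4 : ℝ)) ^ 2 / x ^ 2 := by
    rw [← Real.rpow_natCast (x ^ (1 / 4 : ℝ)) 2, ← Real.rpow_mul hx0.le, ← Real.rpow_natCast x 2,
      ← Real.rpow_sub hx0]
    norm_num
  rw [h2, div_pow, ← mul_div_assoc]
  gcongr
  calc Real.log x ^ 2 ≤ (x ^ (1 / 4 : ℝ) / (1 / 4)) ^ 2 := by gcongr
    _ = _ := by ring

lemma tsum_measure_dyadic_lt_top {Ω : Type*} [MeasurableSpace Ω] {P : Measure Ω}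
    [IsProbabilityMeasure P] {S : ℕ → Ω → Fin 4 → ℤ}
    (hS : IsBERW 4 4 2 P S ∨ IsBERW 4 2 4 P S) (z : Fin 4 → ℤ) :
    ∑' k : ℕ, P {ω | ∃ j : ℕ, 2 ^ k ≤ j ∧ j ≤ 2 ^ (k + 1) ∧ S j ω = z} < ⊤ := by
  obtain ⟨C, hC, h⟩ := exists_measureReal_window_le hS
  have hsum : Summable fun k : ℕ =>
      P.real {ω | ∃ j : ℕ, 2 ^ k ≤ j ∧ j ≤ 2 ^ (k + 1) ∧ S j ω = z} := by
    refine (summable_log_log_dyadic.mul_left C).of_norm_bounded_eventually_nat ?_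
    filter_upwards [eventually_ge_atTop 1] with k hk
    rw [Real.norm_of_nonneg measureReal_nonneg]
    have := h z (2 ^ k) (Nat.one_lt_two_pow (by omega))
    rwa [← pow_succ'] at this
  have hne := hsum.tsum_ofReal_ne_top
  rw [tsum_congr fun k => ofReal_measureReal (measure_ne_top P _)] at hne
  exact hne.lt_top

lemma isTransientWalk_of_tsum_lt_top {Ω : Type*} [MeasurableSpace Ω] {P : Measure Ω}
    {S : ℕ → Ω → Fin 4 → ℤ}
    (h : ∀ z, ∑' k : ℕ, P {ω | ∃ j : ℕ, 2 ^ k ≤ j ∧ j ≤ 2 ^ (k + 1) ∧ S j ω = z} < ⊤) :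
    IsTransientWalk 4 P S := by
  refine ae_all_iff.2 fun z => ?_
  filter_upwards [ae_eventually_notMem (h z).ne] with ω hω
  obtain ⟨K, hK⟩ := eventually_atTop.1 hω
  refine (Set.finite_Iio (2 ^ K)).subset fun n hn => ?_
  by_contra hnK
  have hnK' : 2 ^ K ≤ n := not_lt.1 hnK
  have hn0 : n ≠ 0 := by have := Nat.two_pow_pos K; omega
  refine hK (Nat.log 2 n) (Nat.le_log_of_pow_le (by norm_num) hnK')
    ⟨n, Nat.pow_log_le_self 2 hn0, (Nat.lt_pow_succ_log_self (by norm_num) n).le, hn⟩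

end BERW

/-- For the `M₄(4,2)` balanced excited random walk (and likewise for `M₄(2,4)`):
there is `C > 0` with `P[0 ∈ {S_n, …, S_{2n}}] ≤ C ((log log n)/(log n))²` for every
`n > 1`; consequently `∑_k P[0 ∈ {S_{2^k}, …, S_{2^{k+1}}}] < ∞` and, by
Borel–Cantelli, the walk is transient. -/
theorem berw_M4_4_2_and_2_4_transient {Ω : Type*} [MeasurableSpace Ω]
    (P : Measure Ω) [IsProbabilityMeasure P]
    (S : ℕ → Ω → Fin 4 → ℤ) (hS : IsBERW 4 4 2 P S ∨ IsBERW 4 2 4 P S) :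
    (∃ C : ℝ, 0 < C ∧ ∀ n : ℕ, 1 < n →
      (P {ω | ∃ k : ℕ, n ≤ k ∧ k ≤ 2 * n ∧ S k ω = 0}).toReal
        ≤ C * (Real.log (Real.log n) / Real.log n) ^ 2) ∧
    (∑' k : ℕ, P {ω | ∃ j : ℕ, 2 ^ k ≤ j ∧ j ≤ 2 ^ (k + 1) ∧ S j ω = 0}) < ⊤ ∧
    IsTransientWalk 4 P S := by

  have hsum := BERW.tsum_measure_dyadic_lt_top hS
  obtain ⟨C, hC, h⟩ := BERW.exists_measureReal_window_le hS
  exact ⟨⟨C, hC, h 0⟩, hsum 0, BERW.isTransientWalk_of_tsum_lt_top hsum⟩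
end
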